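/- Suppose v: P_Δ × ℝⁿ → ℝⁿ satisfies the regularity conditions (A1),(A2) and either (A3) (vanishing on the diagonal with small L² bound on v_t's linear growth coefficient) or (A4) (linear growth of v(t,t,·) and v_t with combined coefficient c̃ satisfying ‖c̃‖_{L²} < 1/2). Then the operator V: AC₀² → AC₀², V(x)(t) = x(t) + ∫_α^t v(t,τ,x(τ)) dτ, is a diffeomorphism of AC₀² onto itself. -/

import Mathlib

open MeasureTheory Set Filter

section
variable {E F : Type*} [NormedAddCommGroup E] [NormedSpace ℝ E]
  [NormedAddCommGroup F] [NormedSpace ℝ F]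

lemma hasFDerivAt_of_mixed_partial {α β : ℝ} (hαβ : α < β) {v vt : ℝ → E → F}
    {vx vtx : ℝ → E → E →L[ℝ] F}
    (hvt : ∀ x, ∀ t ∈ Icc α β, HasDerivAt (fun s => v s x) (vt t x) t)
    (hvx : ∀ t x, HasFDerivAt (v t) (vx t x) x)
    (hvtx : ∀ x, ∀ t ∈ Icc α β, HasDerivAt (fun s => vx s x) (vtx t x) t)
    (hc : ContinuousOn (fun p : ℝ × E => vtx p.1 p.2) (Icc α β ×ˢ univ))
    {t : ℝ} (ht : t ∈ Icc α β) (x : E) : HasFDerivAt (vt t) (vtx t x) x := by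
  rw [hasFDerivAt_iff_isLittleO, Asymptotics.isLittleO_iff]
  intro ε hε
  have hct := hc (t, x) ⟨ht, mem_univ _⟩
  rw [Metric.continuousWithinAt_iff] at hct
  obtain ⟨δ, hδ, hd⟩ := hct ε hε
  filter_upwards [Metric.ball_mem_nhds x hδ] with y hy
  set A := vtx t x
  have key1 : ∀ s ∈ Icc α β ∩ Metric.ball t δ, ∀ z ∈ Metric.ball x δ,
      ‖vx s z - vx t z - (s - t) • A‖ ≤ ε * |s - t| := by
    intro s hs z hz
    have := (((convex_Icc α β).inter (convex_ball t δ))).norm_image_sub_le_of_norm_hasDerivWithin_le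
      (f := fun s => vx s z - (s - t) • A) (f' := fun s => vtx s z - A) (C := ε)
      (x := t) (y := s) (fun r hr => ?_) (fun r hr => ?_) ⟨ht, Metric.mem_ball_self hδ⟩ hs
    · simp only [sub_self, zero_smul, sub_zero, Real.norm_eq_abs] at this
      rwa [sub_right_comm] at this
    · have h1 := (hvtx z r hr.1)
      have h2 : HasDerivAt (fun s : ℝ => (s - t) • A) ((1 : ℝ) • A) r :=
        ((hasDerivAt_id r).sub_const t).smul_const A
      rw [one_smul] at h2
      exact (h1.sub h2).hasDerivWithinAt
    · have := hd (x := (r, z)) ⟨hr.1, mem_univ _⟩ (by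
        rw [Prod.dist_eq]; exact max_lt hr.2 hz)
      rw [dist_eq_norm] at this
      exact this.le
  have key2 : ∀ s ∈ Icc α β ∩ Metric.ball t δ,
      ‖(v s y - v t y) - (v s x - v t x) - (s - t) • A (y - x)‖ ≤ ε * |s - t| * ‖y - x‖ := by
    intro s hs
    have := (convex_ball x δ).norm_image_sub_le_of_norm_hasFDerivWithin_le
      (f := fun z => v s z - v t z - (s - t) • A z) (f' := fun z => vx s z - vx t z - (s - t) • A)
      (C := ε * |s - t|) (x := x) (y := y)
      (fun z hz => (((hvx s z).sub (hvx t z)).sub (A.hasFDerivAt.const_smul (s - t))).hasFDerivWithinAt)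
      (fun z hz => key1 s hs z hz) (Metric.mem_ball_self hδ) hy
    convert this using 2
    rw [map_sub, smul_sub]; abel
  have hlim : Tendsto (fun s => ‖(s - t)⁻¹ • ((v s y - v t y) - (v s x - v t x)) - A (y - x)‖)
      (nhdsWithin t (Icc α β \ {t})) (nhds ‖(vt t y - vt t x) - A (y - x)‖) := by
    have h1 := ((hvt y t ht).sub (hvt x t ht)).hasDerivWithinAt (s := Icc α β)
    rw [hasDerivWithinAt_iff_tendsto_slope] at h1
    refine ((h1.sub_const (A (y - x))).norm).congr fun s => ?_
    simp only [slope_def_module, Pi.sub_apply]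
    congr 3
    abel
  have hne : (nhdsWithin t (Icc α β \ {t})).NeBot :=
    accPt_principal_iff_nhdsWithin.1 ((uniqueDiffOn_Icc hαβ) t ht).accPt
  refine le_of_tendsto hlim ?_
  have hb : ∀ᶠ s in nhdsWithin t (Icc α β \ {t}), s ∈ Metric.ball t δ :=
    nhdsWithin_le_nhds (Metric.ball_mem_nhds t hδ)
  filter_upwards [hb, self_mem_nhdsWithin] with s hs1 hs2
  have hst : s - t ≠ 0 := sub_ne_zero.2 hs2.2
  have hst' : 0 < |s - t| := abs_pos.2 hst
  have := key2 s ⟨hs2.1, hs1⟩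
  have e : (s - t)⁻¹ • ((v s y - v t y) - (v s x - v t x)) - A (y - x) =
      (s - t)⁻¹ • ((v s y - v t y) - (v s x - v t x) - (s - t) • A (y - x)) := by
    rw [smul_sub _ _ ((s - t) • A (y - x)), smul_smul, inv_mul_cancel₀ hst, one_smul]
  rw [e, norm_smul, norm_inv, Real.norm_eq_abs]
  calc _ ≤ |s - t|⁻¹ * (ε * |s - t| * ‖y - x‖) := by gcongr
    _ = _ := by field_simp

omit [NormedSpace ℝ E] in
lemma exists_solution_of_contraction [CompleteSpace E] {T : E → E} {q : E → ℝ} {c C : ℝ}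
    (hc : 0 < c) (hC : 0 < C) (hlow : ∀ w, c * ‖w‖ ^ 2 ≤ q w) (hup : ∀ w, q w ≤ C * ‖w‖ ^ 2)
    (hT : ∀ u w, q (T u - T w) ≤ 1 / 4 * q (u - w)) : ∃ u, T u = u := by
  have hlip : ∀ u w, ‖T u - T w‖ ≤ √(C / c) * ‖u - w‖ := by
    intro u w
    refine (le_abs_self _).trans (abs_le_of_sq_le_sq ?_ (by positivity))
    rw [mul_pow, Real.sq_sqrt (by positivity), div_mul_eq_mul_div, le_div_iff₀ hc]
    nlinarith [hlow (T u - T w), hT u w, hup (u - w), hup (T u - T w), hlow (u - w),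
      sq_nonneg ‖u - w‖, mul_nonneg hc.le (sq_nonneg ‖u - w‖)]
  have hcont : Continuous T := by
    refine (LipschitzWith.of_dist_le_mul (K := ⟨√(C / c), Real.sqrt_nonneg _⟩) fun u w => ?_).continuous
    rw [dist_eq_norm, dist_eq_norm]
    exact hlip u w
  have hq : ∀ k, q (T^[k + 1] 0 - T^[k] 0) ≤ (1 / 4) ^ k * q (T 0 - 0) := by
    intro k
    induction k with
    | zero => simp
    | succ k ih =>
      rw [Function.iterate_succ_apply' T (k + 1), Function.iterate_succ_apply' T k]
      rw [Function.iterate_succ_apply' T k] at ih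
      refine (hT _ _).trans ?_
      rw [pow_succ]; linarith
  have hcau : CauchySeq fun k => T^[k] 0 := by
    refine cauchySeq_of_le_geometric (1 / 2) (√(q (T 0 - 0) / c)) (by norm_num) fun k => ?_
    rw [dist_comm, dist_eq_norm]
    have h0 : 0 ≤ q (T 0 - 0) := le_trans (by positivity) (hlow _)
    refine (le_abs_self _).trans (abs_le_of_sq_le_sq ?_ (by positivity))
    rw [mul_pow, Real.sq_sqrt (by positivity), div_mul_eq_mul_div, le_div_iff₀ hc, ← pow_mul,
      mul_comm k 2, pow_mul]
    norm_num
    have := hq k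
    have h2 := hlow (T^[k + 1] 0 - T^[k] 0)
    norm_num at this h2
    linarith
  obtain ⟨u, hu⟩ := cauchySeq_tendsto_of_complete hcau
  refine ⟨u, tendsto_nhds_unique ?_ (hu.comp (tendsto_add_atTop_nat 1))⟩
  have := (hcont.tendsto u).comp hu
  refine this.congr fun k => ?_
  simp [Function.iterate_succ_apply']

end

section
variable {E : Type*} [NormedAddCommGroup E]

lemma Lp_two_norm_sq {Ω : Type*} [MeasurableSpace Ω] {μ : Measure Ω} (f : Lp E 2 μ) :
    ‖f‖ ^ 2 = ∫ t, ‖f t‖ ^ 2 ∂μ := by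
  rw [Lp.norm_def, (Lp.memLp f).eLpNorm_eq_integral_rpow_norm (by norm_num) (by norm_num),
    ENNReal.toReal_ofReal (by positivity)]
  simp only [ENNReal.toReal_ofNat, Real.rpow_ofNat]
  rw [← Real.rpow_natCast, ← Real.rpow_mul (integral_nonneg fun _ => by positivity)]
  norm_num

lemma Lp_two_integrable_norm_sq {Ω : Type*} [MeasurableSpace Ω] {μ : Measure Ω} (f : Lp E 2 μ) :
    Integrable (fun t => ‖f t‖ ^ 2) μ :=
  (memLp_two_iff_integrable_sq_norm (Lp.memLp f).1).1 (Lp.memLp f)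

lemma integral_mul_le_sqrt_mul_sqrt {Ω : Type*} [MeasurableSpace Ω] {μ : Measure Ω} {f g : Ω → ℝ}
    (hf : MemLp f 2 μ) (hg : MemLp g 2 μ) (hf0 : 0 ≤ᵐ[μ] f) (hg0 : 0 ≤ᵐ[μ] g) :
    ∫ a, f a * g a ∂μ ≤ √(∫ a, f a ^ 2 ∂μ) * √(∫ a, g a ^ 2 ∂μ) := by
  have := integral_mul_le_Lp_mul_Lq_of_nonneg Real.HolderConjugate.two_two hf0 hg0
    (by simpa using hf) (by simpa using hg)
  simpa [Real.sqrt_eq_rpow] using this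

/-- The space `L²([α, β], E)`. -/
abbrev IntervalL2 (α β : ℝ) (E : Type*) [NormedAddCommGroup E] : Type _ :=
  Lp E 2 (volume.restrict (Icc α β))

variable {α β : ℝ}

lemma restrict_Ioc_le_restrict_Icc {t : ℝ} (ht : t ∈ Icc α β) :
    (volume : Measure ℝ).restrict (Ioc α t) ≤ volume.restrict (Icc α β) :=
  Measure.restrict_mono (Ioc_subset_Icc_self.trans (Icc_subset_Icc_right ht.2)) le_rfl

lemma Lp_two_intervalIntegrable (u : IntervalL2 α β E) {t : ℝ}
    (ht : t ∈ Icc α β) : IntervalIntegrable u volume α t := by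
  rw [intervalIntegrable_iff_integrableOn_Ioc_of_le ht.1]
  exact ((Lp.memLp u).mono_measure (restrict_Ioc_le_restrict_Icc ht)).integrable (by norm_num)

lemma integrable_exp_mul_norm_sq (r : ℝ) (u : IntervalL2 α β E) :
    Integrable (fun s => Real.exp (-(2 * r * s)) * ‖u s‖ ^ 2) (volume.restrict (Icc α β)) := by
  have hc : ContinuousOn (fun s : ℝ => Real.exp (-(2 * r * s))) (Icc α β) := by fun_prop
  obtain ⟨c, hc⟩ := isCompact_Icc.exists_bound_of_continuousOn hc
  refine (Lp_two_integrable_norm_sq u).bdd_mul (c := c) (by fun_prop) ?_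
  filter_upwards [ae_restrict_mem measurableSet_Icc] with s hs using hc s hs

lemma sq_integral_norm_le_exp {r : ℝ} (hr : 0 < r) (u : IntervalL2 α β E)
    {t : ℝ} (ht : t ∈ Icc α β) :
    (∫ s in α..t, ‖u s‖) ^ 2 ≤ Real.exp (2 * r * t) / (2 * r) *
      ∫ s, Real.exp (-(2 * r * s)) * ‖u s‖ ^ 2 ∂(volume.restrict (Icc α β)) := by
  have hle := restrict_Ioc_le_restrict_Icc ht
  have hu : MemLp u 2 (volume.restrict (Ioc α t)) := (Lp.memLp u).mono_measure hle
  have hint := integrable_exp_mul_norm_sq r u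
  have h1 : MemLp (fun s => Real.exp (r * s)) 2 (volume.restrict (Ioc α t)) := by
    refine MemLp.of_bound (by fun_prop) (Real.exp (r * t)) ?_
    filter_upwards [ae_restrict_mem measurableSet_Ioc] with s hs
    rw [Real.norm_eq_abs, Real.abs_exp]
    gcongr
    exact hs.2
  have h2 : MemLp (fun s => Real.exp (-(r * s)) * ‖u s‖) 2 (volume.restrict (Ioc α t)) := by
    refine (memLp_two_iff_integrable_sq_norm ?_).2 ?_
    · exact AEStronglyMeasurable.mul (by fun_prop) hu.1.norm
    · refine (hint.mono_measure hle).congr (Eventually.of_forall fun s => ?_)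
      simp only [norm_mul, Real.norm_eq_abs, Real.abs_exp, abs_norm, mul_pow, ← Real.exp_nat_mul]
      congr 2
      push_cast; ring
  have key := integral_mul_le_sqrt_mul_sqrt h1 h2 (Eventually.of_forall fun s => by positivity)
    (Eventually.of_forall fun s => by positivity)
  have e1 : ∀ s, Real.exp (r * s) * (Real.exp (-(r * s)) * ‖u s‖) = ‖u s‖ := fun s => by
    rw [← mul_assoc, ← Real.exp_add]; simp
  have e2 : ∀ s, Real.exp (r * s) ^ 2 = Real.exp (2 * r * s) := fun s => by
    rw [← Real.exp_nat_mul]; congr 1; push_cast; ring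
  have e3 : ∀ s, (Real.exp (-(r * s)) * ‖u s‖) ^ 2 = Real.exp (-(2 * r * s)) * ‖u s‖ ^ 2 :=
    fun s => by rw [mul_pow, ← Real.exp_nat_mul]; congr 2; push_cast; ring
  simp only [e1, e2, e3] at key
  have e4 : ∫ s in Ioc α t, Real.exp (2 * r * s) ≤ Real.exp (2 * r * t) / (2 * r) := by
    rw [← intervalIntegral.integral_of_le ht.1,
      intervalIntegral.integral_comp_mul_left (fun s => Real.exp s) (by positivity), integral_exp,
      smul_eq_mul, div_eq_inv_mul]
    gcongr
    exact sub_le_self _ (Real.exp_pos _).le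
  have e5 : ∫ s in Ioc α t, Real.exp (-(2 * r * s)) * ‖u s‖ ^ 2 ≤
      ∫ s, Real.exp (-(2 * r * s)) * ‖u s‖ ^ 2 ∂(volume.restrict (Icc α β)) :=
    integral_mono_measure hle (Eventually.of_forall fun s => by positivity) hint
  rw [intervalIntegral.integral_of_le ht.1]
  have p1 : 0 ≤ ∫ s in Ioc α t, Real.exp (2 * r * s) := integral_nonneg fun s => by positivity
  have p2 : 0 ≤ ∫ s in Ioc α t, Real.exp (-(2 * r * s)) * ‖u s‖ ^ 2 :=
    integral_nonneg fun s => by positivity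
  calc _ ≤ (√(∫ s in Ioc α t, Real.exp (2 * r * s)) *
        √(∫ s in Ioc α t, Real.exp (-(2 * r * s)) * ‖u s‖ ^ 2)) ^ 2 := by
        gcongr
    _ = _ := by rw [mul_pow, Real.sq_sqrt p1, Real.sq_sqrt p2]
    _ ≤ _ := by gcongr

lemma volterra_add_bijective [CompleteSpace E] (hαβ : α < β)
    {N : IntervalL2 α β E → IntervalL2 α β E} {L : ℝ}
    (hN : ∀ u w, ∀ᵐ t ∂(volume.restrict (Icc α β)),
      ‖(N u - N w : IntervalL2 α β E) t‖ ≤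
        L * ∫ s in α..t, ‖(u - w : IntervalL2 α β E) s‖) :
    (∀ f, ∃ u, u + N u = f) ∧ ∃ C, ∀ u w, ‖u - w‖ ≤ C * ‖(u + N u) - (w + N w)‖ := by
  have hβα : 0 < β - α := sub_pos.2 hαβ
  set r : ℝ := 2 * L ^ 2 * (β - α) + 1 with hr
  have hr0 : 0 < r := by positivity
  set q : IntervalL2 α β E → ℝ := fun w => ∫ s, Real.exp (-(2 * r * s)) * ‖w s‖ ^ 2 ∂(volume.restrict (Icc α β)) with hq
  have hI := fun w : IntervalL2 α β E => integrable_exp_mul_norm_sq (α := α) (β := β) r w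
  have hlow : ∀ w, Real.exp (-(2 * r * β)) * ‖w‖ ^ 2 ≤ q w := fun w => by
    rw [Lp_two_norm_sq, ← integral_const_mul]
    refine integral_mono_ae ((Lp_two_integrable_norm_sq w).const_mul _) (hI w) ?_
    filter_upwards [ae_restrict_mem measurableSet_Icc] with s hs
    gcongr
    exact hs.2
  have hup : ∀ w, q w ≤ Real.exp (-(2 * r * α)) * ‖w‖ ^ 2 := fun w => by
    rw [Lp_two_norm_sq, ← integral_const_mul]
    refine integral_mono_ae (hI w) ((Lp_two_integrable_norm_sq w).const_mul _) ?_
    filter_upwards [ae_restrict_mem measurableSet_Icc] with s hs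
    gcongr
    exact hs.1
  have hq0 : ∀ w, 0 ≤ q w := fun w => integral_nonneg fun s => by positivity
  have hqN : ∀ u w, q (N u - N w) ≤ 1 / 4 * q (u - w) := fun u w => by
    have h1 : q (N u - N w) ≤ ∫ s, L ^ 2 / (2 * r) * q (u - w) ∂(volume.restrict (Icc α β)) := by
      refine integral_mono_ae (hI _) (integrable_const _) ?_
      filter_upwards [ae_restrict_mem measurableSet_Icc, hN u w] with s hs hs2
      have h2 := sq_integral_norm_le_exp hr0 (u - w) hs
      calc _ ≤ Real.exp (-(2 * r * s)) *
            (L * ∫ τ in α..s, ‖(u - w : IntervalL2 α β E) τ‖) ^ 2 := by gcongr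
        _ ≤ Real.exp (-(2 * r * s)) *
            (L ^ 2 * (Real.exp (2 * r * s) / (2 * r) * q (u - w))) := by
            rw [mul_pow]; gcongr
        _ = (Real.exp (-(2 * r * s)) * Real.exp (2 * r * s)) * (L ^ 2 / (2 * r) * q (u - w)) := by
            ring
        _ = _ := by rw [← Real.exp_add]; simp
    refine h1.trans ?_
    rw [integral_const, smul_eq_mul, measureReal_restrict_apply_univ,
      Real.volume_real_Icc_of_le hαβ.le, ← mul_assoc]
    refine mul_le_mul_of_nonneg_right ?_ (hq0 _)
    rw [← mul_div_assoc, div_le_iff₀ (by positivity)]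
    linarith
  have hclow : 0 < Real.exp (-(2 * r * β)) := Real.exp_pos _
  have hcup : 0 < Real.exp (-(2 * r * α)) := Real.exp_pos _
  refine ⟨fun f => ?_, √(4 * Real.exp (-(2 * r * α)) / Real.exp (-(2 * r * β))), fun u w => ?_⟩
  · obtain ⟨u, hu⟩ := exists_solution_of_contraction (T := fun u => f - N u) hclow hcup hlow hup
      (fun u w => by
        have e : f - N u - (f - N w) = N w - N u := by abel
        have := hqN w u
        rw [e]
        refine this.trans (le_of_eq ?_)
        congr 1
        refine integral_congr_ae ?_
        rw [← neg_sub]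
        filter_upwards [Lp.coeFn_neg (u - w)] with s hs
        rw [hs]; simp)
    exact ⟨u, eq_sub_iff_add_eq.1 hu.symm⟩
  · set d := (u + N u) - (w + N w) with hd
    have e : u - w = d - (N u - N w) := by rw [hd]; abel
    have h1 : q (u - w) ≤ 2 * q d + 2 * q (N u - N w) := by
      rw [hq]
      simp only
      rw [← integral_const_mul, ← integral_const_mul,
        ← integral_add ((hI _).const_mul _) ((hI _).const_mul _)]
      refine integral_mono_ae (hI _) (((hI _).const_mul _).add ((hI _).const_mul _)) ?_
      rw [e]
      filter_upwards [Lp.coeFn_sub d (N u - N w)] with s hs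
      rw [hs, Pi.sub_apply]
      have := norm_sub_le (d s) ((N u - N w : IntervalL2 α β E) s)
      have h3 : ‖d s - (N u - N w : IntervalL2 α β E) s‖ ^ 2 ≤
          2 * ‖d s‖ ^ 2 + 2 * ‖(N u - N w : IntervalL2 α β E) s‖ ^ 2 := by
        nlinarith [norm_nonneg (d s - (N u - N w : IntervalL2 α β E) s),
          sq_nonneg (‖d s‖ - ‖(N u - N w : IntervalL2 α β E) s‖)]
      have := mul_le_mul_of_nonneg_left h3 (Real.exp_pos (-(2 * r * s))).le
      linarith
    refine (le_abs_self _).trans (abs_le_of_sq_le_sq ?_ (by positivity))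
    rw [mul_pow, Real.sq_sqrt (by positivity), div_mul_eq_mul_div, le_div_iff₀ hclow]
    linarith [hqN u w, hlow (u - w), hup d]

end

section
variable {E F : Type*} [NormedAddCommGroup E] [NormedAddCommGroup F]
variable {α β : ℝ}

/-- Carathéodory kernels `g t τ x` which are locally bounded in `x` on the triangle
`α ≤ τ ≤ t ≤ β`. -/
structure IsCaratheodoryKernel (α β : ℝ) (g : ℝ → ℝ → E → F) : Prop where
  cont : ∀ᵐ τ ∂(volume.restrict (Icc α β)),
    ContinuousOn (fun p : ℝ × E => g p.1 τ p.2) (Icc α β ×ˢ univ)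
  meas : ∀ t ∈ Icc α β, ∀ x, AEStronglyMeasurable (fun τ => g t τ x) (volume.restrict (Icc α β))
  bdd : ∀ ρ > (0 : ℝ), ∃ l > (0 : ℝ), ∀ t τ x, α ≤ τ → τ ≤ t → t ≤ β → ‖x‖ ≤ ρ → ‖g t τ x‖ ≤ l

/-- Measurable functions which are bounded on `[α, β]`. -/
structure IsBoundedPath (α β : ℝ) (x : ℝ → E) : Prop where
  meas : AEStronglyMeasurable x (volume.restrict (Icc α β))
  bdd : ∃ ρ > 0, ∀ t ∈ Icc α β, ‖x t‖ ≤ ρ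

lemma SimpleFunc.aestronglyMeasurable_apply {Ω P : Type*} [MeasurableSpace Ω] {μ : Measure Ω}
    (s : SimpleFunc Ω P) {G : P → Ω → F} (hG : ∀ p, AEStronglyMeasurable (G p) μ) :
    AEStronglyMeasurable (fun ω => G (s ω) ω) μ := by
  classical
  have : (fun ω => G (s ω) ω) = fun ω => ∑ y ∈ s.range, (s ⁻¹' {y}).indicator (G y) ω := by
    funext ω
    rw [Finset.sum_eq_single (s ω)]
    · simp
    · intro y _ hy
      exact indicator_of_notMem (fun h => hy (mem_preimage.1 h).symm) _
    · intro h
      exact absurd (s.mem_range_self ω) h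
  rw [this]
  exact Finset.aestronglyMeasurable_fun_sum _
    fun y _ => (hG y).indicator (s.measurableSet_preimage _)

namespace IsCaratheodoryKernel

variable {g : ℝ → ℝ → E → F}

lemma aestronglyMeasurable_comp (hαβ : α < β) (hg : IsCaratheodoryKernel α β g) {θ : ℝ → ℝ}
    (hθ : AEStronglyMeasurable θ (volume.restrict (Icc α β)))
    (hθm : ∀ τ ∈ Icc α β, θ τ ∈ Icc α β) {x : ℝ → E}
    (hx : AEStronglyMeasurable x (volume.restrict (Icc α β))) :
    AEStronglyMeasurable (fun τ => g (θ τ) τ (x τ)) (volume.restrict (Icc α β)) := by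
  have hξ := hθ.prodMk hx
  set G : ℝ × E → ℝ → F := fun p τ => g (projIcc α β hαβ.le p.1) τ p.2 with hG
  refine aestronglyMeasurable_of_tendsto_ae atTop
    (f := fun k τ => G (hξ.stronglyMeasurable_mk.approx k τ) τ)
    (fun k => SimpleFunc.aestronglyMeasurable_apply _ fun p => hg.meas _ (projIcc α β hαβ.le p.1).2 _) ?_
  filter_upwards [hg.cont, hξ.ae_eq_mk, ae_restrict_mem measurableSet_Icc] with τ h1 h2 h3
  have hcont : Continuous fun p => G p τ := by
    have := h1.comp_continuous (f := fun p : ℝ × E => ((projIcc α β hαβ.le p.1 : ℝ), p.2))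
      (by fun_prop) (fun p => ⟨(projIcc α β hαβ.le p.1).2, mem_univ _⟩)
    exact this
  have := (hcont.tendsto _).comp (hξ.stronglyMeasurable_mk.tendsto_approx τ)
  rw [← h2] at this
  simp only [hG, projIcc_of_mem hαβ.le (hθm τ h3)] at this
  exact this

variable (hαβ : α < β) (hg : IsCaratheodoryKernel α β g) {x : ℝ → E} (hx : IsBoundedPath α β x)
include hαβ hg hx

lemma aestronglyMeasurable_slice {t : ℝ} (ht : t ∈ Icc α β) :
    AEStronglyMeasurable (fun τ => g t τ (x τ)) (volume.restrict (Icc α β)) :=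
  hg.aestronglyMeasurable_comp hαβ aestronglyMeasurable_const (fun _ _ => ht) hx.meas

omit hαβ in
lemma exists_bound_comp : ∃ l > 0, ∀ t τ, α ≤ τ → τ ≤ t → t ≤ β → ‖g t τ (x τ)‖ ≤ l := by
  obtain ⟨ρ, hρ, hb⟩ := hx.bdd
  obtain ⟨l, hl, h⟩ := hg.bdd ρ hρ
  exact ⟨l, hl, fun t τ h1 h2 h3 => h t τ _ h1 h2 h3 (hb τ ⟨h1, h2.trans h3⟩)⟩

lemma intervalIntegrable {t : ℝ} (ht : t ∈ Icc α β) :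
    IntervalIntegrable (fun τ => g t τ (x τ)) volume α t := by
  obtain ⟨l, hl, h⟩ := hg.exists_bound_comp hx
  rw [intervalIntegrable_iff_integrableOn_Ioc_of_le ht.1]
  refine Integrable.of_bound ((hg.aestronglyMeasurable_slice hαβ hx ht).mono_measure
    (restrict_Ioc_le_restrict_Icc ht)) l ?_
  filter_upwards [ae_restrict_mem measurableSet_Ioc] with τ hτ
  exact h t τ hτ.1.le hτ.2 ht.2

variable [NormedSpace ℝ F]

lemma continuousOn_integral :
    ContinuousOn (fun t => ∫ τ in α..t, g t τ (x τ)) (Icc α β) := by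
  obtain ⟨l, hl, hb⟩ := hg.exists_bound_comp hx
  have heq : ∀ t ∈ Icc α β, ∫ τ in α..t, g t τ (x τ) =
      ∫ τ, (Iic t).indicator (fun τ => g t τ (x τ)) τ ∂(volume.restrict (Icc α β)) := by
    intro t ht
    rw [integral_indicator measurableSet_Iic, Measure.restrict_restrict measurableSet_Iic,
      intervalIntegral.integral_of_le ht.1, ← integral_Icc_eq_integral_Ioc]
    congr 2
    ext s
    simp only [mem_Icc, mem_inter_iff, mem_Iic]
    have := ht.2
    grind
  refine ContinuousOn.congr (fun t₀ ht₀ => ?_) heq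
  refine continuousWithinAt_of_dominated (bound := fun _ => l) ?_ ?_ (integrable_const _) ?_
  · filter_upwards [self_mem_nhdsWithin] with t ht
    exact (hg.aestronglyMeasurable_slice hαβ hx ht).indicator measurableSet_Iic
  · filter_upwards [self_mem_nhdsWithin] with t ht
    filter_upwards [ae_restrict_mem measurableSet_Icc] with τ hτ
    rw [indicator_apply]
    split_ifs with h
    · exact hb t τ hτ.1 h ht.2
    · simpa using hl.le
  · have hne : ∀ᵐ τ ∂(volume.restrict (Icc α β)), τ ≠ t₀ :=
      ae_restrict_of_ae (compl_mem_ae_iff.2 (measure_singleton t₀))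
    filter_upwards [hg.cont, hne] with τ hc hτ
    rcases lt_or_gt_of_ne hτ with h | h
    · have h1 : ContinuousWithinAt (fun t => g t τ (x τ)) (Icc α β) t₀ :=
        (hc (t₀, x τ) ⟨ht₀, mem_univ _⟩).comp (f := fun t : ℝ => (t, x τ))
          (by fun_prop) (fun t ht => ⟨ht, mem_univ _⟩)
      refine h1.congr_of_eventuallyEq ?_ (indicator_of_mem (mem_Iic.2 h.le) _)
      filter_upwards [nhdsWithin_le_nhds (Ioi_mem_nhds h)] with t ht
      exact indicator_of_mem (mem_Iic.2 (le_of_lt ht)) _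
    · refine (continuousWithinAt_const (b := (0 : F))).congr_of_eventuallyEq ?_
        (indicator_of_notMem (by simpa using h) _)
      filter_upwards [nhdsWithin_le_nhds (Iio_mem_nhds h)] with t ht
      exact indicator_of_notMem (by simpa using ht) _

end IsCaratheodoryKernel

variable [NormedSpace ℝ F]

/-- The Volterra operator `x ↦ a(t, t, x(t)) + ∫_α^t b(t, τ, x(τ)) dτ`. -/
noncomputable def volterraOp (α : ℝ) (a b : ℝ → ℝ → E → F) (x : ℝ → E) (t : ℝ) : F :=
  a t t (x t) + ∫ τ in α..t, b t τ (x τ)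

variable {a b : ℝ → ℝ → E → F}

lemma aestronglyMeasurable_volterraOp (hαβ : α < β) (ha : IsCaratheodoryKernel α β a)
    (hb : IsCaratheodoryKernel α β b) {x : ℝ → E} (hx : IsBoundedPath α β x) :
    AEStronglyMeasurable (volterraOp α a b x) (volume.restrict (Icc α β)) :=
  (ha.aestronglyMeasurable_comp hαβ (θ := fun τ => τ) (by fun_prop) (fun _ h => h) hx.meas).add
    ((hb.continuousOn_integral hαβ hx).aestronglyMeasurable measurableSet_Icc)

lemma memLp_volterraOp (hαβ : α < β) (ha : IsCaratheodoryKernel α β a)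
    (hb : IsCaratheodoryKernel α β b) {x : ℝ → E} (hx : IsBoundedPath α β x) :
    MemLp (volterraOp α a b x) 2 (volume.restrict (Icc α β)) := by
  obtain ⟨l, hl, h⟩ := ha.exists_bound_comp hx
  obtain ⟨l', hl', h'⟩ := hb.exists_bound_comp hx
  refine MemLp.of_bound (aestronglyMeasurable_volterraOp hαβ ha hb hx) (l + l' * (β - α)) ?_
  filter_upwards [ae_restrict_mem measurableSet_Icc] with t ht
  refine (norm_add_le _ _).trans (add_le_add (h t t ht.1 le_rfl ht.2) ?_)
  refine (intervalIntegral.norm_integral_le_of_norm_le_const (C := l') fun τ hτ => ?_).trans ?_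
  · rw [uIoc_of_le ht.1] at hτ
    exact h' t τ hτ.1.le hτ.2 ht.2
  · rw [abs_of_nonneg (sub_nonneg.2 ht.1)]
    gcongr
    exact ht.2

lemma ae_uIoc_of_ae_restrict_Icc {p : ℝ → Prop} (h : ∀ᵐ τ ∂(volume.restrict (Icc α β)), p τ)
    {t : ℝ} (ht : t ∈ Icc α β) : ∀ᵐ τ : ℝ, τ ∈ uIoc α t → τ ∈ Icc α t ∧ p τ := by
  filter_upwards [(ae_restrict_iff' measurableSet_Icc).1 h] with τ hτ hτ'
  rw [uIoc_of_le ht.1] at hτ'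
  exact ⟨⟨hτ'.1.le, hτ'.2⟩, hτ ⟨hτ'.1.le, hτ'.2.trans ht.2⟩⟩

lemma norm_volterraOp_sub_le (hαβ : α < β) (hb : IsCaratheodoryKernel α β b) {x y : ℝ → E}
    (hx : IsBoundedPath α β x) (hy : IsBoundedPath α β y) {l : ℝ} (hl : 0 ≤ l)
    (hla : ∀ᵐ t ∂(volume.restrict (Icc α β)),
      ‖a t t (x t) - a t t (y t)‖ ≤ l * ‖x t - y t‖)
    (hlb : ∀ᵐ τ ∂(volume.restrict (Icc α β)), ∀ t ∈ Icc τ β,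
      ‖b t τ (x τ) - b t τ (y τ)‖ ≤ l * ‖x τ - y τ‖)
    {m : ℝ → ℝ} (hm : MonotoneOn m (Icc α β)) (hxy : ∀ t ∈ Icc α β, ‖x t - y t‖ ≤ m t) :
    ∀ᵐ t ∂(volume.restrict (Icc α β)),
      ‖volterraOp α a b x t - volterraOp α a b y t‖ ≤ l * (1 + (β - α)) * m t := by
  filter_upwards [hla, ae_restrict_mem measurableSet_Icc] with t hat ht
  have hm0 : 0 ≤ m t := (norm_nonneg _).trans (hxy t ht)
  have e : volterraOp α a b x t - volterraOp α a b y t = (a t t (x t) - a t t (y t)) +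
      ∫ τ in α..t, (b t τ (x τ) - b t τ (y τ)) := by
    rw [intervalIntegral.integral_sub (hb.intervalIntegrable hαβ hx ht)
      (hb.intervalIntegrable hαβ hy ht), volterraOp, volterraOp]
    abel
  have h1 : ‖∫ τ in α..t, (b t τ (x τ) - b t τ (y τ))‖ ≤ l * m t * |t - α| := by
    refine intervalIntegral.norm_integral_le_of_norm_le_const_ae ?_
    filter_upwards [ae_uIoc_of_ae_restrict_Icc hlb ht] with τ h hτ
    obtain ⟨h2, h3⟩ := h hτ
    have hτI : τ ∈ Icc α β := ⟨h2.1, h2.2.trans ht.2⟩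
    exact (h3 t ⟨h2.2, ht.2⟩).trans
      (mul_le_mul_of_nonneg_left ((hxy τ hτI).trans (hm hτI ht h2.2)) hl)
  rw [e]
  calc _ ≤ l * m t + l * m t * |t - α| :=
        (norm_add_le _ _).trans (add_le_add
          (hat.trans (mul_le_mul_of_nonneg_left (hxy t ht) hl)) h1)
    _ ≤ l * m t + l * m t * (β - α) := by
        rw [abs_of_nonneg (sub_nonneg.2 ht.1)]
        gcongr
        exact ht.2
    _ = _ := by ring

end

section
variable {E : Type*} [NormedAddCommGroup E] [NormedSpace ℝ E] {α β : ℝ}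

/-- The primitive of `u` vanishing at `α`. -/
noncomputable def volterraPrimitive (α : ℝ) (u : ℝ → E) (t : ℝ) : E := ∫ s in α..t, u s

omit [NormedSpace ℝ E] in
lemma monotoneOn_integral_norm (u : IntervalL2 α β E) :
    MonotoneOn (fun t => ∫ s in α..t, ‖u s‖) (Icc α β) := by
  intro s hs t ht hst
  refine intervalIntegral.integral_mono_interval le_rfl hs.1 hst
    (Eventually.of_forall fun _ => norm_nonneg _) (Lp_two_intervalIntegrable u ht).norm

omit [NormedSpace ℝ E] in
lemma integral_norm_le_sqrt_mul_norm (u : IntervalL2 α β E) {t : ℝ} (ht : t ∈ Icc α β) :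
    ∫ s in α..t, ‖u s‖ ≤ √(t - α) * ‖u‖ := by
  have hle := restrict_Ioc_le_restrict_Icc ht
  have key := integral_mul_le_sqrt_mul_sqrt (μ := volume.restrict (Ioc α t))
    (f := fun _ => 1) (g := fun s => ‖u s‖) (memLp_const _) ((Lp.memLp u).mono_measure hle).norm
    (Eventually.of_forall fun _ => zero_le_one) (Eventually.of_forall fun _ => norm_nonneg _)
  rw [intervalIntegral.integral_of_le ht.1]
  simp only [one_mul, one_pow, integral_const, smul_eq_mul, mul_one, measureReal_restrict_apply_univ,
    Real.volume_real_Ioc_of_le ht.1] at key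
  refine key.trans ?_
  gcongr
  refine Real.sqrt_le_iff.2 ⟨norm_nonneg _, ?_⟩
  rw [Lp_two_norm_sq]
  exact integral_mono_measure hle (Eventually.of_forall fun _ => by positivity)
    (Lp_two_integrable_norm_sq u)

lemma norm_volterraPrimitive_le_integral (u : ℝ → E) {t : ℝ} (ht : t ∈ Icc α β) :
    ‖volterraPrimitive α u t‖ ≤ ∫ s in α..t, ‖u s‖ :=
  intervalIntegral.norm_integral_le_integral_norm ht.1

lemma norm_volterraPrimitive_le (u : IntervalL2 α β E) {t : ℝ} (ht : t ∈ Icc α β) :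
    ‖volterraPrimitive α u t‖ ≤ √(t - α) * ‖u‖ :=
  (norm_volterraPrimitive_le_integral u ht).trans (integral_norm_le_sqrt_mul_norm u ht)

lemma norm_volterraPrimitive_le' (u : IntervalL2 α β E) {t : ℝ} (ht : t ∈ Icc α β) :
    ‖volterraPrimitive α u t‖ ≤ √(β - α) * ‖u‖ := by
  refine (norm_volterraPrimitive_le u ht).trans ?_
  gcongr
  exact ht.2

lemma isBoundedPath_volterraPrimitive (hαβ : α < β) (u : IntervalL2 α β E) :
    IsBoundedPath α β (volterraPrimitive α u) := by
  have hc : ContinuousOn (volterraPrimitive α u) (Icc α β) := by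
    have := intervalIntegral.continuousOn_primitive_interval (a := α) (b := β) (f := u)
      (μ := volume) ?_
    · rwa [uIcc_of_le hαβ.le] at this
    · rw [uIcc_of_le hαβ.le]
      exact (Lp.memLp u).integrable (by norm_num)
  refine ⟨hc.aestronglyMeasurable measurableSet_Icc, √(β - α) * ‖u‖ + 1, by positivity,
    fun t ht => (norm_volterraPrimitive_le' u ht).trans (by linarith)⟩

lemma intervalIntegral_congr_ae_restrict {u w : ℝ → E}
    (h : u =ᵐ[volume.restrict (Icc α β)] w) {t : ℝ} (ht : t ∈ Icc α β) :
    ∫ s in α..t, u s = ∫ s in α..t, w s := by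
  refine intervalIntegral.integral_congr_ae ?_
  filter_upwards [ae_uIoc_of_ae_restrict_Icc h ht] with τ h hτ using (h hτ).2

lemma volterraPrimitive_sub (u w : IntervalL2 α β E) {t : ℝ} (ht : t ∈ Icc α β) :
    volterraPrimitive α (u - w : IntervalL2 α β E) t =
      volterraPrimitive α u t - volterraPrimitive α w t := by
  simp only [volterraPrimitive]
  rw [← intervalIntegral.integral_sub (Lp_two_intervalIntegrable u ht)
    (Lp_two_intervalIntegrable w ht)]
  exact intervalIntegral_congr_ae_restrict (Lp.coeFn_sub u w) ht

lemma volterraPrimitive_add (u w : IntervalL2 α β E) {t : ℝ} (ht : t ∈ Icc α β) :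
    volterraPrimitive α (u + w : IntervalL2 α β E) t =
      volterraPrimitive α u t + volterraPrimitive α w t := by
  simp only [volterraPrimitive]
  rw [← intervalIntegral.integral_add (Lp_two_intervalIntegrable u ht)
    (Lp_two_intervalIntegrable w ht)]
  exact intervalIntegral_congr_ae_restrict (Lp.coeFn_add u w) ht

lemma volterraPrimitive_smul (c : ℝ) (u : IntervalL2 α β E) {t : ℝ} (ht : t ∈ Icc α β) :
    volterraPrimitive α (c • u : IntervalL2 α β E) t = c • volterraPrimitive α u t := by
  simp only [volterraPrimitive]
  rw [← intervalIntegral.integral_smul]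
  exact intervalIntegral_congr_ae_restrict (Lp.coeFn_smul c u) ht

/-- The radial retraction onto the closed ball of radius `ρ`. -/
noncomputable def radialTrunc (ρ : ℝ) (x : E) : E := (ρ / max ρ ‖x‖) • x

lemma radialTrunc_of_norm_le {ρ : ℝ} (hρ : 0 < ρ) {x : E} (hx : ‖x‖ ≤ ρ) :
    radialTrunc ρ x = x := by
  rw [radialTrunc, max_eq_left hx, div_self hρ.ne', one_smul]

lemma norm_radialTrunc_le {ρ : ℝ} (hρ : 0 < ρ) (x : E) : ‖radialTrunc ρ x‖ ≤ ρ := by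
  have h : 0 < max ρ ‖x‖ := lt_max_of_lt_left hρ
  rw [radialTrunc, norm_smul, Real.norm_of_nonneg (by positivity), div_mul_eq_mul_div,
    div_le_iff₀ h]
  gcongr
  exact le_max_right _ _

lemma norm_radialTrunc_le_norm {ρ : ℝ} (hρ : 0 < ρ) (x : E) : ‖radialTrunc ρ x‖ ≤ ‖x‖ := by
  have h : 0 < max ρ ‖x‖ := lt_max_of_lt_left hρ
  rw [radialTrunc, norm_smul, Real.norm_of_nonneg (by positivity)]
  refine mul_le_of_le_one_left (norm_nonneg _) ((div_le_one h).2 (le_max_left _ _))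

lemma norm_radialTrunc_sub_le {ρ : ℝ} (hρ : 0 < ρ) (x y : E) :
    ‖radialTrunc ρ x - radialTrunc ρ y‖ ≤ 2 * ‖x - y‖ := by
  have ha : 0 < max ρ ‖x‖ := lt_max_of_lt_left hρ
  have hb : 0 < max ρ ‖y‖ := lt_max_of_lt_left hρ
  have hab : |max ρ ‖y‖ - max ρ ‖x‖| ≤ ‖x - y‖ := by
    refine (abs_max_sub_max_le_max _ _ _ _).trans ?_
    rw [sub_self, abs_zero, max_eq_right (abs_nonneg _), norm_sub_rev]
    exact abs_norm_sub_norm_le _ _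
  have e : radialTrunc ρ x - radialTrunc ρ y =
      (ρ / max ρ ‖x‖) • (x - y) + (ρ / max ρ ‖x‖ - ρ / max ρ ‖y‖) • y := by
    rw [radialTrunc, radialTrunc, smul_sub, sub_smul]; abel
  have h1 : ρ / max ρ ‖x‖ ≤ 1 := (div_le_one ha).2 (le_max_left _ _)
  have h2 : |ρ / max ρ ‖x‖ - ρ / max ρ ‖y‖| * ‖y‖ ≤ ‖x - y‖ := by
    have e2 : ρ / max ρ ‖x‖ - ρ / max ρ ‖y‖ =
        (ρ / max ρ ‖x‖) * ((max ρ ‖y‖ - max ρ ‖x‖) / max ρ ‖y‖) := by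
      field_simp
    rw [e2, abs_mul, abs_of_nonneg (by positivity : 0 ≤ ρ / max ρ ‖x‖), abs_div, abs_of_pos hb]
    calc _ ≤ 1 * (‖x - y‖ / max ρ ‖y‖) * max ρ ‖y‖ := by
          gcongr
          exact le_max_right _ _
      _ = _ := by field_simp
  rw [e]
  refine (norm_add_le _ _).trans ?_
  rw [norm_smul, norm_smul, Real.norm_of_nonneg (by positivity : 0 ≤ ρ / max ρ ‖x‖),
    Real.norm_eq_abs]
  nlinarith [norm_nonneg (x - y)]

lemma continuous_radialTrunc {ρ : ℝ} (hρ : 0 < ρ) : Continuous (radialTrunc ρ : E → E) :=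
  (LipschitzWith.of_dist_le_mul (K := 2) fun x y => by
    simpa [dist_eq_norm] using norm_radialTrunc_sub_le hρ x y).continuous

lemma IsBoundedPath.radialTrunc {ρ : ℝ} (hρ : 0 < ρ) {x : ℝ → E} (hx : IsBoundedPath α β x) :
    IsBoundedPath α β fun t => radialTrunc ρ (x t) :=
  ⟨(continuous_radialTrunc hρ).comp_aestronglyMeasurable hx.meas, ρ, hρ,
    fun t _ => norm_radialTrunc_le hρ (x t)⟩

end

section
variable {E F : Type*} [NormedAddCommGroup E] [NormedSpace ℝ E] [NormedAddCommGroup F]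
  [NormedSpace ℝ F] {α β : ℝ}

/-- Carathéodory kernels which are differentiable in the space variable, with a Carathéodory
derivative. -/
structure IsSmoothKernel (α β : ℝ) (g : ℝ → ℝ → E → F) (g' : ℝ → ℝ → E → E →L[ℝ] F) :
    Prop where
  kernel : IsCaratheodoryKernel α β g
  kernel_deriv : IsCaratheodoryKernel α β g'
  hasFDerivAt : ∀ᵐ τ ∂(volume.restrict (Icc α β)), ∀ t ∈ Icc α β, ∀ x,
    HasFDerivAt (g t τ) (g' t τ x) x

lemma IsSmoothKernel.exists_lipschitz {g : ℝ → ℝ → E → F} {g' : ℝ → ℝ → E → E →L[ℝ] F}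
    (hg : IsSmoothKernel α β g g') {ρ : ℝ} (hρ : 0 < ρ) :
    ∃ l > 0, ∀ᵐ τ ∂(volume.restrict (Icc α β)), ∀ t ∈ Icc τ β, ∀ x y, ‖x‖ ≤ ρ → ‖y‖ ≤ ρ →
      ‖g t τ x - g t τ y‖ ≤ l * ‖x - y‖ := by
  obtain ⟨l, hl, h⟩ := hg.kernel_deriv.bdd ρ hρ
  refine ⟨l, hl, ?_⟩
  filter_upwards [hg.hasFDerivAt, ae_restrict_mem measurableSet_Icc] with τ hτ hτI t ht x y hx hy
  have htI : t ∈ Icc α β := ⟨hτI.1.trans ht.1, ht.2⟩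
  exact (convex_closedBall (0 : E) ρ).norm_image_sub_le_of_norm_hasFDerivWithin_le
    (fun z _ => (hτ t htI z).hasFDerivWithinAt)
    (fun z hz => h t τ z hτI.1 ht.1 ht.2 (by simpa using hz)) (by simpa using hy)
    (by simpa using hx)

/-- The linear kernel `g' t τ (x τ)` along a path `x`. -/
def linearizedKernel (g' : ℝ → ℝ → E → E →L[ℝ] F) (x : ℝ → E) (t τ : ℝ) (y : E) : F :=
  g' t τ (x τ) y

lemma IsCaratheodoryKernel.linearized (hαβ : α < β) {g' : ℝ → ℝ → E → E →L[ℝ] F}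
    (hg : IsCaratheodoryKernel α β g') {x : ℝ → E} (hx : IsBoundedPath α β x) :
    IsCaratheodoryKernel α β (linearizedKernel g' x) := by
  refine ⟨?_, fun t ht y => ?_, fun ρ hρ => ?_⟩
  · filter_upwards [hg.cont] with τ hτ
    have h : ContinuousOn (fun p : ℝ × E => g' p.1 τ (x τ)) (Icc α β ×ˢ univ) :=
      hτ.comp (f := fun p : ℝ × E => (p.1, x τ)) (by fun_prop) (fun p hp => ⟨hp.1, mem_univ _⟩)
    exact h.clm_apply continuousOn_snd
  · exact (ContinuousLinearMap.apply ℝ F y).continuous.comp_aestronglyMeasurable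
      (hg.aestronglyMeasurable_slice hαβ hx ht)
  · obtain ⟨l, hl, h⟩ := hg.exists_bound_comp hx
    refine ⟨l * ρ, by positivity, fun t τ y h1 h2 h3 hy => ?_⟩
    exact (ContinuousLinearMap.le_opNorm _ _).trans
      (mul_le_mul (h t τ h1 h2 h3) hy (norm_nonneg _) hl.le)

/-- Evaluation at `t` of the primitive, as a continuous linear map on `L²`. -/
noncomputable def volterraPrimitiveCLM {t : ℝ} (ht : t ∈ Icc α β) : IntervalL2 α β E →L[ℝ] E :=
  LinearMap.mkContinuous
    { toFun := fun u => volterraPrimitive α u t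
      map_add' := fun u w => volterraPrimitive_add u w ht
      map_smul' := fun c u => volterraPrimitive_smul c u ht }
    (√(β - α)) fun u => norm_volterraPrimitive_le' u ht

/-- The first order Taylor remainder of `g` along primitives. -/
noncomputable def taylorRemainder (α : ℝ) (g : ℝ → ℝ → E → F) (g' : ℝ → ℝ → E → E →L[ℝ] F)
    (u w h : ℝ → E) (t τ : ℝ) : F :=
  g t τ (volterraPrimitive α w τ) - g t τ (volterraPrimitive α u τ) -
    linearizedKernel g' (volterraPrimitive α u) t τ (volterraPrimitive α h τ)

namespace IsSmoothKernel
variable {g : ℝ → ℝ → E → F} {g' : ℝ → ℝ → E → E →L[ℝ] F}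

lemma tendsto_taylorRemainder (hg : IsSmoothKernel α β g g') (u : IntervalL2 α β E) :
    ∀ᵐ τ ∂(volume.restrict (Icc α β)), ∀ t ∈ Icc α β,
      Tendsto (fun w : IntervalL2 α β E =>
        ‖w - u‖⁻¹ • taylorRemainder α g g' u w (w - u : IntervalL2 α β E) t τ) (nhds u)
        (nhds 0) := by
  filter_upwards [hg.hasFDerivAt, ae_restrict_mem measurableSet_Icc] with τ hτ hτI t ht
  have h1 : HasFDerivAt (g t τ) (g' t τ (volterraPrimitive α u τ)) (volterraPrimitiveCLM hτI u) :=
    hτ t ht _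
  have := hasFDerivAt_iff_tendsto.1
    (h1.comp u (volterraPrimitiveCLM (E := E) hτI).hasFDerivAt)
  rw [tendsto_zero_iff_norm_tendsto_zero]
  simp only [norm_smul, norm_inv, norm_norm]
  exact this

lemma exists_bound_taylorRemainder (hαβ : α < β) (hg : IsSmoothKernel α β g g')
    (u : IntervalL2 α β E) :
    ∃ C ≥ 0, ∀ᵐ τ ∂(volume.restrict (Icc α β)), ∀ t ∈ Icc τ β, ∀ w ∈ Metric.ball u 1,
      ‖‖w - u‖⁻¹ • taylorRemainder α g g' u w (w - u : IntervalL2 α β E) t τ‖ ≤ C := by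
  set ρ := √(β - α) * (‖u‖ + 1) with hρ
  have hβα : 0 < √(β - α) := Real.sqrt_pos.2 (sub_pos.2 hαβ)
  have hρ0 : 0 < ρ := by positivity
  obtain ⟨l, hl, h⟩ := hg.exists_lipschitz hρ0
  obtain ⟨l', hl', h'⟩ := hg.kernel_deriv.bdd ρ hρ0
  refine ⟨(l + l') * √(β - α), by positivity, ?_⟩
  filter_upwards [h, ae_restrict_mem measurableSet_Icc] with τ hτ hτI t ht w hw
  rw [Metric.mem_ball, dist_eq_norm] at hw
  have hu : ‖volterraPrimitive α u τ‖ ≤ ρ :=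
    (norm_volterraPrimitive_le' u hτI).trans (by rw [hρ]; gcongr; linarith)
  have hwn : ‖w‖ ≤ ‖u‖ + 1 := by
    have := norm_le_norm_add_norm_sub u w
    rw [norm_sub_rev] at this
    linarith
  have hw' : ‖volterraPrimitive α w τ‖ ≤ ρ :=
    (norm_volterraPrimitive_le' w hτI).trans (by rw [hρ]; gcongr)
  have hd := norm_volterraPrimitive_le' (w - u) hτI
  have b1 := hτ t ht _ _ hw' hu
  rw [← volterraPrimitive_sub w u hτI] at b1
  have b2 : ‖linearizedKernel g' (volterraPrimitive α u) t τ
      (volterraPrimitive α (w - u : IntervalL2 α β E) τ)‖ ≤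
      l' * ‖volterraPrimitive α (w - u : IntervalL2 α β E) τ‖ :=
    (ContinuousLinearMap.le_opNorm _ _).trans
      (by gcongr; exact h' t τ _ hτI.1 ht.1 ht.2 hu)
  have b3 : ‖taylorRemainder α g g' u w (w - u : IntervalL2 α β E) t τ‖ ≤
      (l + l') * √(β - α) * ‖w - u‖ := by
    refine (norm_sub_le _ _).trans ((add_le_add b1 b2).trans ?_)
    rw [← add_mul, mul_assoc]
    gcongr
  rw [norm_smul, norm_inv, norm_norm]
  rcases eq_or_ne ‖w - u‖ 0 with h0 | h0
  · rw [h0, inv_zero, zero_mul]; positivity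
  · rw [inv_mul_le_iff₀ (lt_of_le_of_ne (norm_nonneg _) (Ne.symm h0))]
    linarith

end IsSmoothKernel

end

section
variable {E : Type*} [NormedAddCommGroup E] [NormedSpace ℝ E] {α β : ℝ}
  {a b : ℝ → ℝ → E → E} {a' b' : ℝ → ℝ → E → E →L[ℝ] E}

/-- The operator `u ↦ a(t, t, x(t)) + ∫_α^t b(t, τ, x(τ)) dτ` on `L²`, where `x` is the primitive
of `u`. -/
noncomputable def volterraMap (hαβ : α < β) (ha : IsCaratheodoryKernel α β a)
    (hb : IsCaratheodoryKernel α β b) (u : IntervalL2 α β E) : IntervalL2 α β E :=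
  (memLp_volterraOp hαβ ha hb (isBoundedPath_volterraPrimitive hαβ u)).toLp _

lemma coeFn_volterraMap (hαβ : α < β) (ha : IsCaratheodoryKernel α β a)
    (hb : IsCaratheodoryKernel α β b) (u : IntervalL2 α β E) :
    volterraMap hαβ ha hb u =ᵐ[volume.restrict (Icc α β)]
      volterraOp α a b (volterraPrimitive α u) :=
  MemLp.coeFn_toLp _

lemma volterraOp_linearized_add (hαβ : α < β) (hb : IsCaratheodoryKernel α β b') {x : ℝ → E}
    (hx : IsBoundedPath α β x) (u w : IntervalL2 α β E) {t : ℝ} (ht : t ∈ Icc α β) :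
    volterraOp α (linearizedKernel a' x) (linearizedKernel b' x)
        (volterraPrimitive α (u + w : IntervalL2 α β E)) t =
      volterraOp α (linearizedKernel a' x) (linearizedKernel b' x) (volterraPrimitive α u) t +
      volterraOp α (linearizedKernel a' x) (linearizedKernel b' x) (volterraPrimitive α w) t := by
  have hbl := hb.linearized hαβ hx
  simp only [volterraOp]
  rw [volterraPrimitive_add u w ht, linearizedKernel, map_add, add_add_add_comm,
    ← intervalIntegral.integral_add
      (hbl.intervalIntegrable hαβ (isBoundedPath_volterraPrimitive hαβ u) ht)
      (hbl.intervalIntegrable hαβ (isBoundedPath_volterraPrimitive hαβ w) ht)]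
  congr 1
  refine intervalIntegral.integral_congr fun τ hτ => ?_
  rw [uIcc_of_le ht.1] at hτ
  simp only [linearizedKernel]
  rw [volterraPrimitive_add u w ⟨hτ.1, hτ.2.trans ht.2⟩, map_add]

lemma volterraOp_linearized_smul {x : ℝ → E} (c : ℝ) (u : IntervalL2 α β E) {t : ℝ}
    (ht : t ∈ Icc α β) :
    volterraOp α (linearizedKernel a' x) (linearizedKernel b' x)
        (volterraPrimitive α (c • u : IntervalL2 α β E)) t =
      c • volterraOp α (linearizedKernel a' x) (linearizedKernel b' x)
        (volterraPrimitive α u) t := by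
  simp only [volterraOp]
  rw [volterraPrimitive_smul c u ht, linearizedKernel, map_smul, smul_add,
    ← intervalIntegral.integral_smul]
  congr 1
  refine intervalIntegral.integral_congr fun τ hτ => ?_
  rw [uIcc_of_le ht.1] at hτ
  simp only [linearizedKernel]
  rw [volterraPrimitive_smul c u ⟨hτ.1, hτ.2.trans ht.2⟩, map_smul]

lemma exists_norm_volterraMap_linearized_sub_le (hαβ : α < β)
    (ha : IsCaratheodoryKernel α β a') (hb : IsCaratheodoryKernel α β b') {x : ℝ → E}
    (hx : IsBoundedPath α β x) :
    ∃ L ≥ 0, ∀ u w, ∀ᵐ t ∂(volume.restrict (Icc α β)),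
      ‖(volterraMap hαβ (ha.linearized hαβ hx) (hb.linearized hαβ hx) u -
        volterraMap hαβ (ha.linearized hαβ hx) (hb.linearized hαβ hx) w : IntervalL2 α β E) t‖ ≤
        L * ∫ s in α..t, ‖(u - w : IntervalL2 α β E) s‖ := by
  obtain ⟨l, hl, h⟩ := ha.exists_bound_comp hx
  obtain ⟨l', hl', h'⟩ := hb.exists_bound_comp hx
  have hβα := sub_pos.2 hαβ
  refine ⟨max l l' * (1 + (β - α)), by positivity, fun u w => ?_⟩
  have key := norm_volterraOp_sub_le hαβ (a := linearizedKernel a' x) (hb.linearized hαβ hx)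
    (isBoundedPath_volterraPrimitive hαβ u) (isBoundedPath_volterraPrimitive hαβ w)
    (l := max l l') (by positivity) ?_ ?_ (monotoneOn_integral_norm (u - w)) fun t ht => ?_
  · filter_upwards [key, coeFn_volterraMap hαβ (ha.linearized hαβ hx) (hb.linearized hαβ hx) u,
      coeFn_volterraMap hαβ (ha.linearized hαβ hx) (hb.linearized hαβ hx) w,
      Lp.coeFn_sub (volterraMap hαβ (ha.linearized hαβ hx) (hb.linearized hαβ hx) u)
        (volterraMap hαβ (ha.linearized hαβ hx) (hb.linearized hαβ hx) w)] with t h1 h2 h3 h4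
    rwa [h4, Pi.sub_apply, h2, h3]
  · filter_upwards [ae_restrict_mem measurableSet_Icc] with t ht
    simp only [linearizedKernel]
    rw [← map_sub]
    refine (ContinuousLinearMap.le_opNorm _ _).trans ?_
    gcongr
    exact (h t t ht.1 le_rfl ht.2).trans (le_max_left _ _)
  · filter_upwards [ae_restrict_mem measurableSet_Icc] with τ hτ t ht
    simp only [linearizedKernel]
    rw [← map_sub]
    refine (ContinuousLinearMap.le_opNorm _ _).trans ?_
    gcongr
    exact (h' t τ hτ.1 ht.1 ht.2).trans (le_max_right _ _)
  · rw [← volterraPrimitive_sub u w ht]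
    exact norm_volterraPrimitive_le_integral _ ht

/-- The linearization of `volterraMap` along a path `x`. -/
noncomputable def volterraDeriv (hαβ : α < β) (ha : IsCaratheodoryKernel α β a')
    (hb : IsCaratheodoryKernel α β b') {x : ℝ → E} (hx : IsBoundedPath α β x) :
    IntervalL2 α β E →L[ℝ] IntervalL2 α β E :=
  LinearMap.mkContinuousOfExistsBound
    { toFun := volterraMap hαβ (ha.linearized hαβ hx) (hb.linearized hαβ hx)
      map_add' := fun u w => by
        refine Lp.ext ?_
        filter_upwards [coeFn_volterraMap hαβ (ha.linearized hαβ hx) (hb.linearized hαβ hx) u,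
          coeFn_volterraMap hαβ (ha.linearized hαβ hx) (hb.linearized hαβ hx) w,
          coeFn_volterraMap hαβ (ha.linearized hαβ hx) (hb.linearized hαβ hx) (u + w),
          Lp.coeFn_add (volterraMap hαβ (ha.linearized hαβ hx) (hb.linearized hαβ hx) u)
            (volterraMap hαβ (ha.linearized hαβ hx) (hb.linearized hαβ hx) w),
          ae_restrict_mem measurableSet_Icc] with t h1 h2 h3 h4 ht
        rw [h3, h4, Pi.add_apply, h1, h2, volterraOp_linearized_add hαβ hb hx u w ht]
      map_smul' := fun c u => by
        refine Lp.ext ?_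
        filter_upwards [coeFn_volterraMap hαβ (ha.linearized hαβ hx) (hb.linearized hαβ hx) u,
          coeFn_volterraMap hαβ (ha.linearized hαβ hx) (hb.linearized hαβ hx) (c • u),
          Lp.coeFn_smul c (volterraMap hαβ (ha.linearized hαβ hx) (hb.linearized hαβ hx) u),
          ae_restrict_mem measurableSet_Icc] with t h1 h2 h3 ht
        rw [h2, RingHom.id_apply, h3, Pi.smul_apply, h1, volterraOp_linearized_smul c u ht] }
    (by
      obtain ⟨L, hL, h⟩ := exists_norm_volterraMap_linearized_sub_le hαβ ha hb hx
      have h0 : volterraMap hαβ (ha.linearized hαβ hx) (hb.linearized hαβ hx) 0 = 0 := by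
        refine Lp.ext ?_
        filter_upwards [coeFn_volterraMap hαβ (ha.linearized hαβ hx) (hb.linearized hαβ hx) 0,
          Lp.coeFn_zero E 2 (volume.restrict (Icc α β)),
          ae_restrict_mem measurableSet_Icc] with t h1 h2 ht
        have := volterraOp_linearized_smul (a' := a') (b' := b') (x := x) 0
          (0 : IntervalL2 α β E) ht
        rw [h1, h2, Pi.zero_apply, ← zero_smul ℝ (0 : IntervalL2 α β E), this, zero_smul]
      refine ⟨measureUnivNNReal (volume.restrict (Icc α β)) ^ (2 : ENNReal).toReal⁻¹ *
        (L * √(β - α)), fun u => ?_⟩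
      rw [mul_assoc]
      refine Lp.norm_le_of_ae_bound (by positivity) ?_
      filter_upwards [h u 0, ae_restrict_mem measurableSet_Icc] with t h1 ht
      rw [h0, sub_zero, sub_zero] at h1
      refine h1.trans ?_
      rw [mul_assoc]
      gcongr
      refine (integral_norm_le_sqrt_mul_norm u ht).trans ?_
      gcongr
      exact ht.2)

lemma volterraDeriv_apply (hαβ : α < β) (ha : IsCaratheodoryKernel α β a')
    (hb : IsCaratheodoryKernel α β b') {x : ℝ → E} (hx : IsBoundedPath α β x)
    (u : IntervalL2 α β E) :
    volterraDeriv hαβ ha hb hx u =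
      volterraMap hαβ (ha.linearized hαβ hx) (hb.linearized hαβ hx) u := rfl

end

section
variable {E : Type*} [NormedAddCommGroup E] [NormedSpace ℝ E] {α β : ℝ}
  {a b : ℝ → ℝ → E → E} {a' b' : ℝ → ℝ → E → E →L[ℝ] E}

lemma IsSmoothKernel.intervalIntegrable_taylorRemainder (hαβ : α < β)
    (hb : IsSmoothKernel α β b b') (u w : IntervalL2 α β E) {t : ℝ} (ht : t ∈ Icc α β) :
    IntervalIntegrable (fun τ => taylorRemainder α b b' u w (w - u : IntervalL2 α β E) t τ)
      volume α t :=
  ((hb.kernel.intervalIntegrable hαβ (isBoundedPath_volterraPrimitive hαβ w) ht).sub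
    (hb.kernel.intervalIntegrable hαβ (isBoundedPath_volterraPrimitive hαβ u) ht)).sub
    ((hb.kernel_deriv.linearized hαβ (isBoundedPath_volterraPrimitive hαβ u)).intervalIntegrable
      hαβ (isBoundedPath_volterraPrimitive hαβ (w - u)) ht)

lemma volterraMap_taylor_ae_eq (hαβ : α < β) (sa : IsSmoothKernel α β a a')
    (sb : IsSmoothKernel α β b b') (u w : IntervalL2 α β E) :
    (‖w - u‖⁻¹ • (volterraMap hαβ sa.kernel sb.kernel w - volterraMap hαβ sa.kernel sb.kernel u -
      volterraDeriv hαβ sa.kernel_deriv sb.kernel_deriv (isBoundedPath_volterraPrimitive hαβ u)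
        (w - u)) : IntervalL2 α β E) =ᵐ[volume.restrict (Icc α β)] fun t =>
      ‖w - u‖⁻¹ • taylorRemainder α a a' u w (w - u : IntervalL2 α β E) t t +
        ∫ τ in α..t, ‖w - u‖⁻¹ • taylorRemainder α b b' u w (w - u : IntervalL2 α β E) t τ := by
  have hu := isBoundedPath_volterraPrimitive hαβ u
  have hal := sa.kernel_deriv.linearized hαβ hu
  have hbl := sb.kernel_deriv.linearized hαβ hu
  rw [volterraDeriv_apply]
  filter_upwards [Lp.coeFn_smul ‖w - u‖⁻¹ (volterraMap hαβ sa.kernel sb.kernel w -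
      volterraMap hαβ sa.kernel sb.kernel u - volterraMap hαβ hal hbl (w - u)),
    Lp.coeFn_sub (volterraMap hαβ sa.kernel sb.kernel w - volterraMap hαβ sa.kernel sb.kernel u)
      (volterraMap hαβ hal hbl (w - u)),
    Lp.coeFn_sub (volterraMap hαβ sa.kernel sb.kernel w) (volterraMap hαβ sa.kernel sb.kernel u),
    coeFn_volterraMap hαβ sa.kernel sb.kernel w, coeFn_volterraMap hαβ sa.kernel sb.kernel u,
    coeFn_volterraMap hαβ hal hbl (w - u), ae_restrict_mem measurableSet_Icc]
    with t h1 h2 h3 h4 h5 h6 ht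
  rw [h1, Pi.smul_apply, h2, Pi.sub_apply, h3, Pi.sub_apply, h4, h5, h6,
    intervalIntegral.integral_smul, ← smul_add]
  congr 1
  simp only [volterraOp, taylorRemainder]
  have i1 := sb.kernel.intervalIntegrable hαβ (isBoundedPath_volterraPrimitive hαβ w) ht
  have i2 := sb.kernel.intervalIntegrable hαβ hu ht
  have i3 := hbl.intervalIntegrable hαβ (isBoundedPath_volterraPrimitive hαβ (w - u)) ht
  rw [intervalIntegral.integral_sub (i1.sub i2) i3, intervalIntegral.integral_sub i1 i2]
  abel

lemma hasFDerivAt_volterraMap (hαβ : α < β) (sa : IsSmoothKernel α β a a')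
    (sb : IsSmoothKernel α β b b') (u : IntervalL2 α β E) :
    HasFDerivAt (volterraMap hαβ sa.kernel sb.kernel)
      (volterraDeriv hαβ sa.kernel_deriv sb.kernel_deriv
        (isBoundedPath_volterraPrimitive hαβ u)) u := by
  rw [hasFDerivAt_iff_tendsto]
  set D : IntervalL2 α β E → ℝ → E := fun w t =>
    ‖w - u‖⁻¹ • taylorRemainder α a a' u w (w - u : IntervalL2 α β E) t t +
      ∫ τ in α..t, ‖w - u‖⁻¹ • taylorRemainder α b b' u w (w - u : IntervalL2 α β E) t τ with hD
  obtain ⟨Ca, hCa, ha⟩ := sa.exists_bound_taylorRemainder hαβ u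
  obtain ⟨Cb, hCb, hb⟩ := sb.exists_bound_taylorRemainder hαβ u
  have hball : ∀ᶠ w in nhds u, w ∈ Metric.ball u 1 := Metric.ball_mem_nhds _ one_pos
  have hint : Tendsto (fun w => ∫ t, ‖D w t‖ ^ 2 ∂(volume.restrict (Icc α β))) (nhds u)
      (nhds (∫ _, 0 ∂(volume.restrict (Icc α β)))) := by
    refine tendsto_integral_filter_of_dominated_convergence
      (fun _ => (Ca + Cb * (β - α)) ^ 2) ?_ ?_ (integrable_const _) ?_
    · refine Eventually.of_forall fun w => ?_
      exact (((Lp.aestronglyMeasurable _).congr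
        (volterraMap_taylor_ae_eq hαβ sa sb u w)).norm.pow 2)
    · filter_upwards [hball] with w hw
      filter_upwards [ha, ae_restrict_mem measurableSet_Icc] with t hat ht
      rw [norm_pow, norm_norm]
      gcongr
      refine (norm_add_le _ _).trans (add_le_add (hat t ⟨le_rfl, ht.2⟩ w hw) ?_)
      refine (intervalIntegral.norm_integral_le_of_norm_le_const_ae (C := Cb) ?_).trans ?_
      · filter_upwards [ae_uIoc_of_ae_restrict_Icc hb ht] with τ hτ hτ'
        exact (hτ hτ').2 t ⟨(hτ hτ').1.2, ht.2⟩ w hw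
      · rw [abs_of_nonneg (sub_nonneg.2 ht.1)]
        gcongr
        exact ht.2
    · filter_upwards [sa.tendsto_taylorRemainder u, ae_restrict_mem measurableSet_Icc]
        with t hat ht
      have h2 : Tendsto (fun w : IntervalL2 α β E => ∫ τ in α..t,
          ‖w - u‖⁻¹ • taylorRemainder α b b' u w (w - u : IntervalL2 α β E) t τ) (nhds u)
          (nhds (∫ _ in α..t, 0)) := by
        refine intervalIntegral.tendsto_integral_filter_of_dominated_convergence (fun _ => Cb)
          ?_ ?_ intervalIntegrable_const ?_
        · refine Eventually.of_forall fun w => ?_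
          have := (sb.intervalIntegrable_taylorRemainder hαβ u w ht).smul ‖w - u‖⁻¹
          exact this.def'.1
        · filter_upwards [hball] with w hw
          filter_upwards [ae_uIoc_of_ae_restrict_Icc hb ht] with τ hτ hτ'
          exact (hτ hτ').2 t ⟨(hτ hτ').1.2, ht.2⟩ w hw
        · filter_upwards [ae_uIoc_of_ae_restrict_Icc (sb.tendsto_taylorRemainder u) ht]
            with τ hτ hτ'
          exact (hτ hτ').2 t ht
      have h3 := ((hat t ht).add h2).norm.pow 2
      rw [intervalIntegral.integral_zero, add_zero, norm_zero, zero_pow two_ne_zero] at h3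
      exact h3
  have hsq : ∀ w, ‖w - u‖⁻¹ * ‖volterraMap hαβ sa.kernel sb.kernel w -
      volterraMap hαβ sa.kernel sb.kernel u - volterraDeriv hαβ sa.kernel_deriv sb.kernel_deriv
        (isBoundedPath_volterraPrimitive hαβ u) (w - u)‖ =
      √(∫ t, ‖D w t‖ ^ 2 ∂(volume.restrict (Icc α β))) := fun w => by
    rw [← Real.sqrt_sq (by positivity : 0 ≤ ‖w - u‖⁻¹ * ‖volterraMap hαβ sa.kernel sb.kernel w -
      volterraMap hαβ sa.kernel sb.kernel u - volterraDeriv hαβ sa.kernel_deriv sb.kernel_deriv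
        (isBoundedPath_volterraPrimitive hαβ u) (w - u)‖)]
    congr 1
    rw [← norm_norm (w - u), ← norm_inv, ← norm_smul, Lp_two_norm_sq]
    refine integral_congr_ae ?_
    filter_upwards [volterraMap_taylor_ae_eq hαβ sa sb u w] with t ht
    rw [ht]
  simp only [hsq]
  simpa using hint.sqrt

lemma exists_continuousLinearEquiv_id_add_volterraDeriv [CompleteSpace E] (hαβ : α < β)
    (ha : IsCaratheodoryKernel α β a') (hb : IsCaratheodoryKernel α β b') {x : ℝ → E}
    (hx : IsBoundedPath α β x) :
    ∃ e : IntervalL2 α β E ≃L[ℝ] IntervalL2 α β E,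
      (e : IntervalL2 α β E →L[ℝ] IntervalL2 α β E) =
        ContinuousLinearMap.id ℝ _ + volterraDeriv hαβ ha hb hx := by
  obtain ⟨L, -, hL⟩ := exists_norm_volterraMap_linearized_sub_le hαβ ha hb hx
  obtain ⟨hsurj, C, hC⟩ := volterra_add_bijective hαβ hL
  refine ⟨ContinuousLinearEquiv.ofBijective
    (ContinuousLinearMap.id ℝ _ + volterraDeriv hαβ ha hb hx) ?_ ?_, ?_⟩
  · refine LinearMap.ker_eq_bot.2 fun u w h => ?_
    have h' : u + volterraMap hαβ (ha.linearized hαβ hx) (hb.linearized hαβ hx) u =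
      w + volterraMap hαβ (ha.linearized hαβ hx) (hb.linearized hαβ hx) w := h
    have := hC u w
    rw [h', sub_self, norm_zero, mul_zero] at this
    exact sub_eq_zero.1 (norm_le_zero_iff.1 this)
  · exact LinearMap.range_eq_top.2 fun f => hsurj f
  · exact ContinuousLinearEquiv.coe_ofBijective _ _ _

lemma exists_norm_toLp_radialTrunc_sub_le (hαβ : α < β) (sa : IsSmoothKernel α β a a')
    (sb : IsSmoothKernel α β b b') {ρ : ℝ} (hρ : 0 < ρ) :
    ∃ L, ∀ u w : IntervalL2 α β E, ∀ᵐ t ∂(volume.restrict (Icc α β)),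
      ‖((memLp_volterraOp hαβ sa.kernel sb.kernel
          ((isBoundedPath_volterraPrimitive hαβ u).radialTrunc hρ)).toLp _ -
        (memLp_volterraOp hαβ sa.kernel sb.kernel
          ((isBoundedPath_volterraPrimitive hαβ w).radialTrunc hρ)).toLp _ :
          IntervalL2 α β E) t‖ ≤ L * ∫ s in α..t, ‖(u - w : IntervalL2 α β E) s‖ := by
  obtain ⟨l, hl, h⟩ := sa.exists_lipschitz hρ
  obtain ⟨l', hl', h'⟩ := sb.exists_lipschitz hρ
  refine ⟨max l l' * (1 + (β - α)) * 2, fun u w => ?_⟩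
  have key := norm_volterraOp_sub_le hαβ (a := a) sb.kernel
    ((isBoundedPath_volterraPrimitive hαβ u).radialTrunc hρ)
    ((isBoundedPath_volterraPrimitive hαβ w).radialTrunc hρ) (l := max l l') (by positivity) ?_ ?_
    (m := fun t => 2 * ∫ s in α..t, ‖(u - w : IntervalL2 α β E) s‖)
    (fun s hs t ht hst => mul_le_mul_of_nonneg_left (monotoneOn_integral_norm (u - w) hs ht hst)
      zero_le_two) fun t ht => ?_
  · filter_upwards [key, Lp.coeFn_sub ((memLp_volterraOp hαβ sa.kernel sb.kernel
          ((isBoundedPath_volterraPrimitive hαβ u).radialTrunc hρ)).toLp _)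
        ((memLp_volterraOp hαβ sa.kernel sb.kernel
          ((isBoundedPath_volterraPrimitive hαβ w).radialTrunc hρ)).toLp _),
      (memLp_volterraOp hαβ sa.kernel sb.kernel
        ((isBoundedPath_volterraPrimitive hαβ u).radialTrunc hρ)).coeFn_toLp,
      (memLp_volterraOp hαβ sa.kernel sb.kernel
        ((isBoundedPath_volterraPrimitive hαβ w).radialTrunc hρ)).coeFn_toLp] with t h1 h2 h3 h4
    rwa [h2, Pi.sub_apply, h3, h4, mul_assoc]
  · filter_upwards [h, ae_restrict_mem measurableSet_Icc] with t h1 ht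
    refine (h1 t ⟨le_rfl, ht.2⟩ _ _ (norm_radialTrunc_le hρ _) (norm_radialTrunc_le hρ _)).trans ?_
    gcongr
    exact le_max_left _ _
  · filter_upwards [h'] with τ h1 t ht
    refine (h1 t ht _ _ (norm_radialTrunc_le hρ _) (norm_radialTrunc_le hρ _)).trans ?_
    gcongr
    exact le_max_right _ _
  · refine (norm_radialTrunc_sub_le hρ _ _).trans ?_
    rw [← volterraPrimitive_sub u w ht]
    gcongr
    exact norm_volterraPrimitive_le_integral _ ht

lemma volterraMap_eq_toLp_radialTrunc (hαβ : α < β) (ha : IsCaratheodoryKernel α β a)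
    (hb : IsCaratheodoryKernel α β b) {ρ : ℝ} (hρ : 0 < ρ) {u : IntervalL2 α β E}
    (hu : √(β - α) * ‖u‖ ≤ ρ) :
    volterraMap hαβ ha hb u = (memLp_volterraOp hαβ ha hb
      ((isBoundedPath_volterraPrimitive hαβ u).radialTrunc hρ)).toLp _ := by
  refine (MemLp.toLp_eq_toLp_iff _ _).2 ?_
  have heq : ∀ t ∈ Icc α β, radialTrunc ρ (volterraPrimitive α u t) = volterraPrimitive α u t :=
    fun t ht => radialTrunc_of_norm_le hρ ((norm_volterraPrimitive_le' u ht).trans hu)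
  filter_upwards [ae_restrict_mem measurableSet_Icc] with t ht
  simp only [volterraOp]
  rw [heq t ht]
  congr 1
  refine intervalIntegral.integral_congr fun τ hτ => ?_
  rw [uIcc_of_le ht.1] at hτ
  simp only [heq τ ⟨hτ.1, hτ.2.trans ht.2⟩]

/-- A Volterra operator with smooth kernels of sublinear size is a diffeomorphism of `L²`. -/
theorem id_add_volterraMap_diffeomorph [CompleteSpace E] (hαβ : α < β)
    (sa : IsSmoothKernel α β a a') (sb : IsSmoothKernel α β b b') {κ C : ℝ} (hκ : κ < 1)
    (hap : ∀ (u : IntervalL2 α β E) (x : ℝ → E) (hx : IsBoundedPath α β x),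
      (∀ t ∈ Icc α β, ‖x t‖ ≤ √(t - α) * ‖u‖) →
        ‖(memLp_volterraOp hαβ sa.kernel sb.kernel hx).toLp _‖ ≤ κ * ‖u‖ + C) :
    Function.Bijective (fun u => u + volterraMap hαβ sa.kernel sb.kernel u) ∧
    Differentiable ℝ (fun u => u + volterraMap hαβ sa.kernel sb.kernel u) ∧
    ∃ Winv, Function.LeftInverse Winv (fun u => u + volterraMap hαβ sa.kernel sb.kernel u) ∧
      Function.RightInverse Winv (fun u => u + volterraMap hαβ sa.kernel sb.kernel u) ∧
      Differentiable ℝ Winv := by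
  set N := volterraMap hαβ sa.kernel sb.kernel with hN
  set T : ∀ ρ : ℝ, 0 < ρ → IntervalL2 α β E → IntervalL2 α β E := fun ρ hρ u =>
    (memLp_volterraOp hαβ sa.kernel sb.kernel
      ((isBoundedPath_volterraPrimitive hαβ u).radialTrunc hρ)).toLp _ with hT
  have hκ' : 0 < 1 - κ := sub_pos.2 hκ
  have hR : ∀ R : ℝ, ∃ ρ, ∃ hρ : 0 < ρ, ∀ u, ‖u‖ ≤ R → N u = T ρ hρ u := fun R => by
    have hρ : 0 < √(β - α) * |R| + 1 := by positivity
    refine ⟨_, hρ, fun u hu => volterraMap_eq_toLp_radialTrunc hαβ sa.kernel sb.kernel hρ ?_⟩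
    have := mul_le_mul_of_nonneg_left (hu.trans (le_abs_self R)) (Real.sqrt_nonneg (β - α))
    linarith
  have hTn : ∀ ρ hρ u, ‖T ρ hρ u‖ ≤ κ * ‖u‖ + C := fun ρ hρ u =>
    hap u _ ((isBoundedPath_volterraPrimitive hαβ u).radialTrunc hρ) fun t ht =>
      (norm_radialTrunc_le_norm hρ _).trans (norm_volterraPrimitive_le u ht)
  have hNn : ∀ u, ‖N u‖ ≤ κ * ‖u‖ + C := fun u => by
    obtain ⟨ρ, hρ, h⟩ := hR ‖u‖
    rw [h u le_rfl]
    exact hTn ρ hρ u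
  have hap' : ∀ {u z f : IntervalL2 α β E}, ‖z‖ ≤ κ * ‖u‖ + C → u + z = f →
      ‖u‖ ≤ (‖f‖ + C) / (1 - κ) := fun {u z f} hz h => by
    rw [le_div_iff₀ hκ']
    have : u = f - z := by rw [← h]; abel
    have h1 : ‖u‖ ≤ ‖f‖ + ‖z‖ := by rw [this]; exact norm_sub_le _ _
    linarith
  have hbij : ∀ ρ hρ, (∀ f, ∃ u, u + T ρ hρ u = f) ∧
      ∃ K, ∀ u w, ‖u - w‖ ≤ K * ‖(u + T ρ hρ u) - (w + T ρ hρ w)‖ := fun ρ hρ => by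
    obtain ⟨L, hL⟩ := exists_norm_toLp_radialTrunc_sub_le hαβ sa sb hρ
    exact volterra_add_bijective hαβ hL
  have hLip : ∀ M : ℝ, ∃ K, ∀ u w, ‖u + N u‖ ≤ M → ‖w + N w‖ ≤ M →
      ‖u - w‖ ≤ K * ‖(u + N u) - (w + N w)‖ := fun M => by
    obtain ⟨ρ, hρ, h⟩ := hR ((M + C) / (1 - κ))
    obtain ⟨K, hK⟩ := (hbij ρ hρ).2
    refine ⟨K, fun u w hu hw => ?_⟩
    have hb : ∀ u, ‖u + N u‖ ≤ M → N u = T ρ hρ u := fun u hu =>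
      h u ((hap' (hNn u) rfl).trans (by gcongr))
    rw [hb u hu, hb w hw]
    exact hK u w
  have hinj : Function.Injective fun u => u + N u := fun u w huw => by
    obtain ⟨K, hK⟩ := hLip ‖u + N u‖
    have huw' : u + N u = w + N w := huw
    have := hK u w le_rfl (by rw [huw'])
    rw [huw', sub_self, norm_zero, mul_zero] at this
    exact sub_eq_zero.1 (norm_le_zero_iff.1 this)
  have hsurj : Function.Surjective fun u => u + N u := fun f => by
    obtain ⟨ρ, hρ, h⟩ := hR ((‖f‖ + C) / (1 - κ))
    obtain ⟨u, hu⟩ := (hbij ρ hρ).1 f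
    exact ⟨u, by simp only; rw [h u (hap' (hTn ρ hρ u) hu), hu]⟩
  have hderiv : ∀ u, HasFDerivAt (fun u => u + N u) (ContinuousLinearMap.id ℝ _ +
      volterraDeriv hαβ sa.kernel_deriv sb.kernel_deriv
        (isBoundedPath_volterraPrimitive hαβ u)) u := fun u =>
    (hasFDerivAt_id u).add (hasFDerivAt_volterraMap hαβ sa sb u)
  obtain ⟨G, hGl, hGr⟩ := Function.bijective_iff_has_inverse.1 ⟨hinj, hsurj⟩
  refine ⟨⟨hinj, hsurj⟩, fun u => (hderiv u).differentiableAt, G, hGl, hGr, fun f => ?_⟩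
  have hcont : ContinuousAt G f := by
    obtain ⟨K, hK⟩ := hLip (‖f‖ + 1)
    refine continuousAt_of_locally_lipschitz one_pos K fun y hy => ?_
    have hGy : G y + N (G y) = y := hGr y
    have hGf : G f + N (G f) = f := hGr f
    have hy' : ‖y‖ ≤ ‖f‖ + 1 := by
      rw [dist_eq_norm] at hy
      have := norm_le_norm_add_norm_sub f y
      rw [norm_sub_rev] at this
      linarith
    have := hK (G y) (G f) (by rwa [hGy]) (by rw [hGf]; linarith)
    rwa [hGy, hGf, ← dist_eq_norm, ← dist_eq_norm] at this
  obtain ⟨e, he⟩ := exists_continuousLinearEquiv_id_add_volterraDeriv hαβ sa.kernel_deriv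
    sb.kernel_deriv (isBoundedPath_volterraPrimitive hαβ (G f))
  have hd := hderiv (G f)
  rw [← he] at hd
  exact (hd.of_local_left_inverse hcont (Eventually.of_forall hGr)).differentiableAt

end

section
variable {α β : ℝ}

lemma integrable_intervalIntegral_of_integrableOn_triangle {f : ℝ → ℝ → ℝ}
    (hf : IntegrableOn (fun p : ℝ × ℝ => f p.1 p.2)
      {p : ℝ × ℝ | α ≤ p.2 ∧ p.2 ≤ p.1 ∧ p.1 ≤ β}) :
    (∀ᵐ t ∂(volume.restrict (Icc α β)), IntegrableOn (f t) (Ioc α t)) ∧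
      Integrable (fun t => ∫ τ in α..t, f t τ) (volume.restrict (Icc α β)) := by
  have hT : MeasurableSet {p : ℝ × ℝ | α ≤ p.2 ∧ p.2 ≤ p.1 ∧ p.1 ≤ β} :=
    (measurableSet_le measurable_const measurable_snd).inter
      ((measurableSet_le measurable_snd measurable_fst).inter
        (measurableSet_le measurable_fst measurable_const))
  rw [← integrable_indicator_iff hT, Measure.volume_eq_prod] at hf
  have hsec : ∀ t ∈ Icc α β, (fun τ => indicator {p : ℝ × ℝ | α ≤ p.2 ∧ p.2 ≤ p.1 ∧ p.1 ≤ β}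
      (fun p : ℝ × ℝ => f p.1 p.2) (t, τ)) = (Icc α t).indicator (f t) := fun t ht => by
    funext τ
    simp only [indicator, mem_ofPred_eq, mem_Icc, ht.2, and_true]
  constructor
  · filter_upwards [ae_restrict_of_ae hf.prod_right_ae, ae_restrict_mem measurableSet_Icc]
      with t h1 ht
    rw [hsec t ht, integrable_indicator_iff measurableSet_Icc] at h1
    exact h1.mono_set Ioc_subset_Icc_self
  · refine (hf.integral_prod_left.restrict (s := Icc α β)).congr ?_
    filter_upwards [ae_restrict_mem measurableSet_Icc] with t ht
    rw [hsec t ht, integral_indicator measurableSet_Icc, integral_Icc_eq_integral_Ioc,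
      intervalIntegral.integral_of_le ht.1]

lemma memLp_two_of_integrable_sq {Ω : Type*} [MeasurableSpace Ω] {μ : Measure Ω} {f : Ω → ℝ}
    (hf0 : ∀ x, 0 ≤ f x) (hf : Integrable (fun x => f x ^ 2) μ) : MemLp f 2 μ := by
  refine (memLp_two_iff_integrable_sq ?_).2 hf
  have := hf.1.aemeasurable.sqrt.aestronglyMeasurable
  simpa only [Real.sqrt_sq (hf0 _)] using this

lemma integral_Ioc_sub_left {t : ℝ} (ht : α ≤ t) :
    ∫ τ in Ioc α t, (τ - α) = (t - α) ^ 2 / 2 := by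
  rw [← intervalIntegral.integral_of_le ht, intervalIntegral.integral_comp_sub_right (fun τ => τ),
    integral_id]
  ring

lemma integral_linear_bound_le {t : ℝ} (ht : t ∈ Icc α β) {c d : ℝ → ℝ} (hc0 : ∀ τ, 0 ≤ c τ)
    (hd0 : ∀ τ, 0 ≤ d τ) (hc : IntegrableOn (fun τ => c τ ^ 2) (Ioc α t))
    (hd : IntegrableOn (fun τ => d τ ^ 2) (Ioc α t)) {r : ℝ} (hr : 0 ≤ r) :
    IntervalIntegrable (fun τ => c τ * (√(τ - α) * r) + d τ) volume α t ∧
    ∫ τ in α..t, (c τ * (√(τ - α) * r) + d τ) ≤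
      (β - α) / √2 * √(∫ τ in α..t, c τ ^ 2) * r + √(β - α) * √(∫ τ in α..t, d τ ^ 2) := by
  have hs : MemLp (fun τ => √(τ - α)) 2 (volume.restrict (Ioc α t)) := by
    refine MemLp.of_bound (by fun_prop) (√(t - α)) ?_
    filter_upwards [ae_restrict_mem measurableSet_Ioc] with τ hτ
    rw [Real.norm_of_nonneg (Real.sqrt_nonneg _)]
    exact Real.sqrt_le_sqrt (by linarith [hτ.2])
  have hc2 := memLp_two_of_integrable_sq hc0 hc
  have hd2 := memLp_two_of_integrable_sq hd0 hd
  have hcs : Integrable (fun τ => c τ * (√(τ - α) * r)) (volume.restrict (Ioc α t)) := by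
    simpa only [mul_assoc, Pi.mul_apply] using (hc2.integrable_mul hs).mul_const r
  have hd1 : Integrable d (volume.restrict (Ioc α t)) := hd2.integrable (by norm_num)
  refine ⟨(intervalIntegrable_iff_integrableOn_Ioc_of_le ht.1).2 (hcs.add hd1), ?_⟩
  simp only [intervalIntegral.integral_of_le ht.1]
  rw [integral_add hcs hd1]
  refine add_le_add ?_ ?_
  · simp only [← mul_assoc]
    rw [integral_mul_const]
    refine mul_le_mul_of_nonneg_right ?_ hr
    refine (integral_mul_le_sqrt_mul_sqrt hc2 hs (Eventually.of_forall hc0)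
      (Eventually.of_forall fun _ => Real.sqrt_nonneg _)).trans ?_
    have e : ∫ τ in Ioc α t, √(τ - α) ^ 2 = (t - α) ^ 2 / 2 := by
      rw [← integral_Ioc_sub_left ht.1]
      refine setIntegral_congr_fun measurableSet_Ioc fun τ hτ => ?_
      exact Real.sq_sqrt (sub_nonneg.2 hτ.1.le)
    rw [e, Real.sqrt_div (sq_nonneg _), Real.sqrt_sq (sub_nonneg.2 ht.1), mul_comm]
    gcongr
    exact ht.2
  · have := integral_mul_le_sqrt_mul_sqrt (μ := volume.restrict (Ioc α t)) (f := fun _ => 1)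
      (memLp_const _) hd2 (Eventually.of_forall fun _ => zero_le_one) (Eventually.of_forall hd0)
    simp only [one_mul, one_pow, integral_const, smul_eq_mul, mul_one,
      measureReal_restrict_apply_univ, Real.volume_real_Ioc_of_le ht.1] at this
    refine this.trans ?_
    gcongr
    exact ht.2

variable {E : Type*} [NormedAddCommGroup E] [NormedSpace ℝ E] {a b : ℝ → ℝ → E → E}

/-- The size of a Volterra operator with kernels of linear growth. -/
lemma exists_norm_toLp_volterraOp_le (hαβ : α < β) (ha : IsCaratheodoryKernel α β a)
    (hb : IsCaratheodoryKernel α β b) {c₁ d₁ : ℝ → ℝ} {c₂ d₂ : ℝ → ℝ → ℝ}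
    (hc₁0 : ∀ t, 0 ≤ c₁ t) (hd₁0 : ∀ t, 0 ≤ d₁ t) (hc₂0 : ∀ t τ, 0 ≤ c₂ t τ)
    (hd₂0 : ∀ t τ, 0 ≤ d₂ t τ) (hac : ∀ t ∈ Icc α β, ∀ x, ‖a t t x‖ ≤ c₁ t * ‖x‖ + d₁ t)
    (hbc : ∀ t τ x, α ≤ τ → τ ≤ t → t ≤ β → ‖b t τ x‖ ≤ c₂ t τ * ‖x‖ + d₂ t τ)
    (hc₁ : IntegrableOn (fun t => c₁ t ^ 2) (Icc α β))
    (hd₁ : IntegrableOn (fun t => d₁ t ^ 2) (Icc α β))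
    (hc₂ : IntegrableOn (fun p : ℝ × ℝ => c₂ p.1 p.2 ^ 2)
      {p : ℝ × ℝ | α ≤ p.2 ∧ p.2 ≤ p.1 ∧ p.1 ≤ β})
    (hd₂ : IntegrableOn (fun p : ℝ × ℝ => d₂ p.1 p.2 ^ 2)
      {p : ℝ × ℝ | α ≤ p.2 ∧ p.2 ≤ p.1 ∧ p.1 ≤ β}) :
    ∃ C, ∀ (u : IntervalL2 α β E) (x : ℝ → E) (hx : IsBoundedPath α β x),
      (∀ t ∈ Icc α β, ‖x t‖ ≤ √(t - α) * ‖u‖) →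
        ‖(memLp_volterraOp hαβ ha hb hx).toLp _‖ ≤
          √(∫ t in α..β, (√(t - α) * c₁ t +
            (β - α) / √2 * √(∫ τ in α..t, c₂ t τ ^ 2)) ^ 2) * ‖u‖ + C := by
  obtain ⟨hc₂s, hc₂i⟩ := integrable_intervalIntegral_of_integrableOn_triangle
    (f := fun t τ => c₂ t τ ^ 2) hc₂
  obtain ⟨hd₂s, hd₂i⟩ := integrable_intervalIntegral_of_integrableOn_triangle
    (f := fun t τ => d₂ t τ ^ 2) hd₂
  have hsqrt : ∀ g : ℝ → ℝ → ℝ,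
      Integrable (fun t => ∫ τ in α..t, g t τ ^ 2) (volume.restrict (Icc α β)) →
      MemLp (fun t => √(∫ τ in α..t, g t τ ^ 2)) 2 (volume.restrict (Icc α β)) := fun g hg => by
    refine memLp_two_of_integrable_sq (fun _ => Real.sqrt_nonneg _) (hg.congr ?_)
    filter_upwards [ae_restrict_mem measurableSet_Icc] with t ht
    rw [Real.sq_sqrt (intervalIntegral.integral_nonneg ht.1 fun _ _ => sq_nonneg _)]
  have hs : MemLp (fun t => √(t - α) * c₁ t) 2 (volume.restrict (Icc α β)) := by
    have h1 := memLp_two_of_integrable_sq hc₁0 hc₁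
    have h2 : AEStronglyMeasurable (fun t => √(t - α)) (volume.restrict (Icc α β)) := by fun_prop
    refine h1.of_le_mul (c := √(β - α)) (h2.mul h1.1) ?_
    filter_upwards [ae_restrict_mem measurableSet_Icc] with t ht
    rw [norm_mul, Real.norm_of_nonneg (Real.sqrt_nonneg _)]
    gcongr
    exact ht.2
  set c : ℝ → ℝ := fun t => √(t - α) * c₁ t + (β - α) / √2 * √(∫ τ in α..t, c₂ t τ ^ 2) with hc
  set d : ℝ → ℝ := fun t => d₁ t + √(β - α) * √(∫ τ in α..t, d₂ t τ ^ 2) with hd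
  have mc : MemLp c 2 (volume.restrict (Icc α β)) := hs.add ((hsqrt c₂ hc₂i).const_mul _)
  have md : MemLp d 2 (volume.restrict (Icc α β)) :=
    (memLp_two_of_integrable_sq hd₁0 hd₁).add ((hsqrt d₂ hd₂i).const_mul _)
  have hnorm : √(∫ t in α..β, c t ^ 2) = ‖mc.toLp c‖ := by
    rw [← Real.sqrt_sq (norm_nonneg (mc.toLp c)), Lp_two_norm_sq,
      intervalIntegral.integral_of_le hαβ.le, ← integral_Icc_eq_integral_Ioc]
    congr 1
    refine integral_congr_ae ?_
    filter_upwards [mc.coeFn_toLp] with t ht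
    rw [ht, Real.norm_eq_abs, sq_abs]
  refine ⟨‖md.toLp d‖, fun u x hx hxu => ?_⟩
  rw [hnorm]
  have key : ‖(memLp_volterraOp hαβ ha hb hx).toLp _‖ ≤ ‖‖u‖ • mc.toLp c + md.toLp d‖ := by
    refine Lp.norm_le_norm_of_ae_le ?_
    filter_upwards [(memLp_volterraOp hαβ ha hb hx).coeFn_toLp, mc.coeFn_toLp, md.coeFn_toLp,
      Lp.coeFn_add (‖u‖ • mc.toLp c) (md.toLp d), Lp.coeFn_smul ‖u‖ (mc.toLp c), hc₂s, hd₂s,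
      ae_restrict_mem measurableSet_Icc] with t h1 h2 h3 h4 h5 h6 h7 ht
    rw [h1, h4, Pi.add_apply, h5, Pi.smul_apply, h2, h3, smul_eq_mul]
    refine le_trans ?_ (Real.le_norm_self _)
    obtain ⟨hi, hle⟩ := integral_linear_bound_le ht (hc₂0 t) (hd₂0 t) h6 h7 (norm_nonneg u)
    have h8 : ‖a t t (x t)‖ ≤ c₁ t * (√(t - α) * ‖u‖) + d₁ t :=
      (hac t ht _).trans (by gcongr; exacts [hc₁0 t, hxu t ht])
    have h9 : ‖∫ τ in α..t, b t τ (x τ)‖ ≤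
        ∫ τ in α..t, (c₂ t τ * (√(τ - α) * ‖u‖) + d₂ t τ) := by
      refine intervalIntegral.norm_integral_le_of_norm_le ht.1
        (Eventually.of_forall fun τ hτ => ?_) hi
      refine (hbc t τ _ hτ.1.le hτ.2 ht.2).trans ?_
      gcongr
      exacts [hc₂0 t τ, hxu τ ⟨hτ.1.le, hτ.2.trans ht.2⟩]
    refine (norm_add_le _ _).trans ((add_le_add h8 (h9.trans hle)).trans (le_of_eq ?_))
    simp only [hc, hd]
    ring
  refine key.trans ((norm_add_le _ _).trans ?_)
  rw [norm_smul, norm_norm, mul_comm]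

end

/-- under (A1), (A2) and either (A3) or (A4), the Volterra-type operator
`V(x)(t) = x(t) + ∫_α^t v(t,τ,x(τ))dτ` is a diffeomorphism of `AC₀²` onto itself.  `AC₀²`
is identified with `L²([α,β],ℝⁿ)` via `x ↦ x'` (so `x(t) = ∫_α^t x'`); in these
coordinates `V` acts as `u ↦ (t ↦ u(t) + v(t,t,x(t)) + ∫_α^t v_t(t,τ,x(τ))dτ)` with
`x(τ) = ∫_α^τ u`, and the conclusion asserts the existence of a map `W` on `L²`
a.e.-represented by this formula which is a differentiable bijection with differentiable
inverse. -/
theorem stmt14 (n : ℕ) (α β : ℝ) (hαβ : α < β)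
    (v vt : ℝ → ℝ → EuclideanSpace ℝ (Fin n) → EuclideanSpace ℝ (Fin n))
    (vx vtx : ℝ → ℝ → EuclideanSpace ℝ (Fin n) →
      (EuclideanSpace ℝ (Fin n) →L[ℝ] EuclideanSpace ℝ (Fin n)))
    -- (A1)
    (hA1a : ∀ᵐ τ ∂(volume.restrict (Set.Icc α β)),
      ContinuousOn (fun p : ℝ × EuclideanSpace ℝ (Fin n) => v p.1 τ p.2)
        (Set.Icc α β ×ˢ Set.univ))
    (hA1b : (∀ τ x, ∀ t ∈ Set.Icc α β, HasDerivAt (fun s => v s τ x) (vt t τ x) t) ∧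
      ∀ᵐ τ ∂(volume.restrict (Set.Icc α β)),
        ContinuousOn (fun p : ℝ × EuclideanSpace ℝ (Fin n) => vt p.1 τ p.2)
          (Set.Icc α β ×ˢ Set.univ))
    (hA1c : (∀ t τ x, HasFDerivAt (fun ξ => v t τ ξ) (vx t τ x) x) ∧
      ∀ᵐ τ ∂(volume.restrict (Set.Icc α β)),
        ContinuousOn (fun p : ℝ × EuclideanSpace ℝ (Fin n) => vx p.1 τ p.2)
          (Set.Icc α β ×ˢ Set.univ))
    (hA1d : (∀ τ x, ∀ t ∈ Set.Icc α β, HasDerivAt (fun s => vx s τ x) (vtx t τ x) t) ∧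
      ∀ᵐ τ ∂(volume.restrict (Set.Icc α β)),
        ContinuousOn (fun p : ℝ × EuclideanSpace ℝ (Fin n) => vtx p.1 τ p.2)
          (Set.Icc α β ×ˢ Set.univ))
    -- (A2)
    (hA2meas : ∀ t x,
      AEStronglyMeasurable (fun τ => v t τ x) (volume.restrict (Set.Icc α β)) ∧
      AEStronglyMeasurable (fun τ => vt t τ x) (volume.restrict (Set.Icc α β)) ∧
      AEStronglyMeasurable (fun τ => vx t τ x) (volume.restrict (Set.Icc α β)) ∧
      AEStronglyMeasurable (fun τ => vtx t τ x) (volume.restrict (Set.Icc α β)))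
    (hA2bd : ∀ ρ > (0:ℝ), ∃ l > (0:ℝ), ∀ t τ (x : EuclideanSpace ℝ (Fin n)),
      α ≤ τ → τ ≤ t → t ≤ β → ‖x‖ ≤ ρ →
      ‖v t τ x‖ ≤ l ∧ ‖vt t τ x‖ ≤ l ∧ ‖vx t τ x‖ ≤ l ∧ ‖vtx t τ x‖ ≤ l)
    -- (A3) or (A4)
    (hA34 :
      (∃ c₀ d₀ : ℝ → ℝ → ℝ,
        (∀ t ∈ Set.Icc α β, ∀ x, v t t x = 0) ∧
        (∀ t τ, 0 ≤ c₀ t τ) ∧ (∀ t τ, 0 ≤ d₀ t τ) ∧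
        (∀ t τ x, α ≤ τ → τ ≤ t → t ≤ β → ‖vt t τ x‖ ≤ c₀ t τ * ‖x‖ + d₀ t τ) ∧
        MeasureTheory.IntegrableOn (fun p : ℝ × ℝ => (c₀ p.1 p.2) ^ 2)
          {p : ℝ × ℝ | α ≤ p.2 ∧ p.2 ≤ p.1 ∧ p.1 ≤ β} ∧
        MeasureTheory.IntegrableOn (fun p : ℝ × ℝ => (d₀ p.1 p.2) ^ 2)
          {p : ℝ × ℝ | α ≤ p.2 ∧ p.2 ≤ p.1 ∧ p.1 ≤ β} ∧
        Real.sqrt (∫ t in α..β, ∫ τ in α..t, (c₀ t τ) ^ 2) <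
          Real.sqrt 2 / (2 * (β - α))) ∨
      (∃ (c₁ d₁ : ℝ → ℝ) (c₂ d₂ : ℝ → ℝ → ℝ),
        (∀ t, 0 ≤ c₁ t) ∧ (∀ t, 0 ≤ d₁ t) ∧
        (∀ t τ, 0 ≤ c₂ t τ) ∧ (∀ t τ, 0 ≤ d₂ t τ) ∧
        (∀ t ∈ Set.Icc α β, ∀ x, ‖v t t x‖ ≤ c₁ t * ‖x‖ + d₁ t) ∧
        (∀ t τ x, α ≤ τ → τ ≤ t → t ≤ β → ‖vt t τ x‖ ≤ c₂ t τ * ‖x‖ + d₂ t τ) ∧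
        MeasureTheory.IntegrableOn (fun t => (c₁ t) ^ 2) (Set.Icc α β) ∧
        MeasureTheory.IntegrableOn (fun t => (d₁ t) ^ 2) (Set.Icc α β) ∧
        MeasureTheory.IntegrableOn (fun p : ℝ × ℝ => (c₂ p.1 p.2) ^ 2)
          {p : ℝ × ℝ | α ≤ p.2 ∧ p.2 ≤ p.1 ∧ p.1 ≤ β} ∧
        MeasureTheory.IntegrableOn (fun p : ℝ × ℝ => (d₂ p.1 p.2) ^ 2)
          {p : ℝ × ℝ | α ≤ p.2 ∧ p.2 ≤ p.1 ∧ p.1 ≤ β} ∧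
        Real.sqrt (∫ t in α..β,
            (Real.sqrt (t - α) * c₁ t +
              (β - α) / Real.sqrt 2 *
                Real.sqrt (∫ τ in α..t, (c₂ t τ) ^ 2)) ^ 2) < 1 / 2)) :
    ∃ W : Lp (EuclideanSpace ℝ (Fin n)) 2 (volume.restrict (Set.Icc α β)) →
        Lp (EuclideanSpace ℝ (Fin n)) 2 (volume.restrict (Set.Icc α β)),
      -- W is the derivative-coordinate realization of V
      (∀ u, ∀ᵐ t ∂(volume.restrict (Set.Icc α β)),
        W u t = u t + v t t (∫ s in α..t, u s) +
          ∫ τ in α..t, vt t τ (∫ s in α..τ, u s)) ∧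
      -- V is a diffeomorphism
      Function.Bijective W ∧ Differentiable ℝ W ∧
        ∃ Winv, Function.LeftInverse Winv W ∧ Function.RightInverse Winv W ∧
          Differentiable ℝ Winv := by
  have ka : IsCaratheodoryKernel α β v :=
    ⟨hA1a, fun t _ x => (hA2meas t x).1, fun ρ hρ => by
      obtain ⟨l, hl, h⟩ := hA2bd ρ hρ
      exact ⟨l, hl, fun t τ x h1 h2 h3 h4 => (h t τ x h1 h2 h3 h4).1⟩⟩
  have kb : IsCaratheodoryKernel α β vt :=
    ⟨hA1b.2, fun t _ x => (hA2meas t x).2.1, fun ρ hρ => by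
      obtain ⟨l, hl, h⟩ := hA2bd ρ hρ
      exact ⟨l, hl, fun t τ x h1 h2 h3 h4 => (h t τ x h1 h2 h3 h4).2.1⟩⟩
  have ka' : IsCaratheodoryKernel α β vx :=
    ⟨hA1c.2, fun t _ x => (hA2meas t x).2.2.1, fun ρ hρ => by
      obtain ⟨l, hl, h⟩ := hA2bd ρ hρ
      exact ⟨l, hl, fun t τ x h1 h2 h3 h4 => (h t τ x h1 h2 h3 h4).2.2.1⟩⟩
  have kb' : IsCaratheodoryKernel α β vtx :=
    ⟨hA1d.2, fun t _ x => (hA2meas t x).2.2.2, fun ρ hρ => by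
      obtain ⟨l, hl, h⟩ := hA2bd ρ hρ
      exact ⟨l, hl, fun t τ x h1 h2 h3 h4 => (h t τ x h1 h2 h3 h4).2.2.2⟩⟩
  have sa : IsSmoothKernel α β v vx :=
    ⟨ka, ka', Eventually.of_forall fun τ t _ x => hA1c.1 t τ x⟩
  have sb : IsSmoothKernel α β vt vtx := by
    refine ⟨kb, kb', ?_⟩
    filter_upwards [hA1d.2] with τ hτ t ht x
    exact hasFDerivAt_of_mixed_partial (v := fun t x => v t τ x) (vt := fun t x => vt t τ x)
      (vx := fun t x => vx t τ x) (vtx := fun t x => vtx t τ x) hαβ (hA1b.1 τ)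
      (fun t x => hA1c.1 t τ x) (hA1d.1 τ) hτ ht x
  obtain ⟨κ, C, hκ, hap⟩ : ∃ κ C : ℝ, κ < 1 ∧
      ∀ (u : IntervalL2 α β (EuclideanSpace ℝ (Fin n))) (x : ℝ → EuclideanSpace ℝ (Fin n))
        (hx : IsBoundedPath α β x),
        (∀ t ∈ Icc α β, ‖x t‖ ≤ √(t - α) * ‖u‖) →
          ‖(memLp_volterraOp hαβ ka kb hx).toLp _‖ ≤ κ * ‖u‖ + C := by
    rcases hA34 with ⟨c₀, d₀, hv, hc0, hd0, hb, hc, hd, hlt⟩ |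
      ⟨c₁, d₁, c₂, d₂, hc₁0, hd₁0, hc₂0, hd₂0, hac, hbc, hc₁, hd₁, hc₂, hd₂, hlt⟩
    · obtain ⟨C, hC⟩ := exists_norm_toLp_volterraOp_le hαβ ka kb (c₁ := fun _ => 0)
        (d₁ := fun _ => 0) (fun _ => le_rfl) (fun _ => le_rfl) hc0 hd0
        (fun t ht x => by rw [hv t ht x]; simp) hb (by simp) (by simp) hc hd
      refine ⟨_, C, ?_, hC⟩
      have hβα : 0 < β - α := sub_pos.2 hαβ
      have e : ∫ t in α..β, (√(t - α) * 0 + (β - α) / √2 * √(∫ τ in α..t, c₀ t τ ^ 2)) ^ 2 =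
          ((β - α) / √2) ^ 2 * ∫ t in α..β, ∫ τ in α..t, c₀ t τ ^ 2 := by
        rw [← intervalIntegral.integral_const_mul]
        refine intervalIntegral.integral_congr fun t ht => ?_
        rw [uIcc_of_le hαβ.le] at ht
        simp only [mul_zero, zero_add, mul_pow]
        rw [Real.sq_sqrt (intervalIntegral.integral_nonneg ht.1 fun _ _ => sq_nonneg _)]
      rw [e, Real.sqrt_mul (sq_nonneg _), Real.sqrt_sq (by positivity)]
      calc _ < (β - α) / √2 * (√2 / (2 * (β - α))) := by gcongr
        _ = 1 / 2 := by field_simp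
        _ < 1 := by norm_num
    · obtain ⟨C, hC⟩ := exists_norm_toLp_volterraOp_le hαβ ka kb hc₁0 hd₁0 hc₂0 hd₂0 hac hbc
        hc₁ hd₁ hc₂ hd₂
      exact ⟨_, C, hlt.trans (by norm_num), hC⟩
  refine ⟨fun u => u + volterraMap hαβ ka kb u, fun u => ?_,
    id_add_volterraMap_diffeomorph hαβ sa sb hκ hap⟩
  filter_upwards [Lp.coeFn_add u (volterraMap hαβ ka kb u), coeFn_volterraMap hαβ ka kb u]
    with t h1 h2
  rw [h1, Pi.add_apply, h2, add_assoc]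
  rfl
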